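/- arXiv:1907.10166 — 2 statements merged into one kernel-verified Lean document; each statement's English description precedes it below -/
import Mathlib

section
/- Let G be a group acting $(k,n)$-acylindrically on a simplicial tree T. Then for any loxodromic element a ∈ G and any nonzero integer m, there exist at most n elements b ∈ G satisfying a = b^m. -/
namespace SimpleGraph

variable {V G : Type*} {T : SimpleGraph V}

lemma IsTree.length_eq_dist_of_isPath (hT : T.IsTree) {u v : V} {p : T.Walk u v}
    (hp : p.IsPath) : p.length = T.dist u v := by
  obtain ⟨q, hq, hlen⟩ := hT.connected.exists_path_of_dist u v
  rw [(hT.existsUnique_path u v).unique hp hq, hlen]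

lemma IsTree.dist_add_dist_of_mem_support (hT : T.IsTree) {u v w : V} {p : T.Walk u v}
    (hp : p.IsPath) (hw : w ∈ p.support) : T.dist u w + T.dist w v = T.dist u v := by
  classical
  rw [← hT.length_eq_dist_of_isPath hp, ← hT.length_eq_dist_of_isPath (hp.takeUntil hw),
    ← hT.length_eq_dist_of_isPath (hp.dropUntil hw), ← Walk.length_append, Walk.take_spec]

/-- In a tree, a geodesic between two vertices on different sides of an edge crosses it. -/
lemma IsTree.dist_eq_of_adj_of_lt (hT : T.IsTree) {x x' y z : V} (h : T.Adj x x')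
    (hz : T.dist z x < T.dist z x') (hy : T.dist x' y < T.dist x y) :
    T.dist z y = T.dist z x + 1 + T.dist x' y := by
  obtain ⟨p, hp, hpl⟩ := hT.connected.exists_path_of_dist z x
  obtain ⟨q, hq, hql⟩ := hT.connected.exists_path_of_dist x' y
  have hx' : x' ∉ p.support := fun hmem => by
    have := hT.dist_add_dist_of_mem_support hp hmem
    lia
  have hx : x ∉ q.support := fun hmem => by
    have := hT.dist_add_dist_of_mem_support hq hmem
    lia
  have hcons : (Walk.cons h q).IsPath := hq.cons hx
  have hpath : (p.append (Walk.cons h q)).IsPath := by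
    rw [hT.isAcyclic.isPath_iff_isChain] at hp hcons ⊢
    rw [Walk.edges_append, List.isChain_append]
    refine ⟨hp, hcons, ?_⟩
    rintro e he e' he' rfl
    simp only [Walk.edges_cons, List.head?_cons, Option.mem_some_iff] at he'
    subst he'
    exact hx' (p.snd_mem_support_of_mem_edges (List.mem_of_mem_getLast? he))
  have hlen := hT.length_eq_dist_of_isPath hpath
  rw [Walk.length_append, Walk.length_cons] at hlen
  lia

lemma Connected.exists_adj_dist_add_one (hT : T.Connected) {x y : V} (h : x ≠ y) :
    ∃ x', T.Adj x x' ∧ T.dist x' y + 1 = T.dist x y := by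
  obtain ⟨p, hp⟩ := hT.exists_walk_length_eq_dist x y
  cases p with
  | nil => exact absurd rfl h
  | @cons _ x' _ hadj q =>
    refine ⟨x', hadj, ?_⟩
    rw [Walk.length_cons] at hp
    have h1 := dist_le q
    have h2 := hT.dist_triangle (u := x) (v := x') (w := y)
    have h3 := dist_eq_one_iff_adj.mpr hadj
    lia

/-- The four-point condition: trees are `0`-hyperbolic. -/
lemma IsTree.dist_add_dist_le (hT : T.IsTree) (x y z w : V) :
    T.dist x y + T.dist z w ≤ T.dist x z + T.dist y w ∨
      T.dist x y + T.dist z w ≤ T.dist x w + T.dist y z := by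
  induction hd : T.dist x y generalizing x with
  | zero =>
    obtain rfl := hT.connected.dist_eq_zero_iff.mp hd
    left
    have := hT.connected.dist_triangle (u := z) (v := x) (w := w)
    rw [T.dist_comm (u := z) (v := x)] at this
    lia
  | succ d ih =>
    have hne : x ≠ y := by
      rintro rfl
      simp at hd
    obtain ⟨x', hadj, hx'⟩ := hT.connected.exists_adj_dist_add_one hne
    have hih := ih x' (by lia)
    have crossing {u v : V} (hu : T.dist u x < T.dist u x') (hv : T.dist v x' < T.dist v x) :
        T.dist u v = T.dist u x + 1 + T.dist v x' := by
      rw [T.dist_comm (u := v), T.dist_comm (u := v)] at hv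
      rw [hT.dist_eq_of_adj_of_lt hadj hu hv, T.dist_comm (u := x')]
    rw [T.dist_comm (u := x), T.dist_comm (u := x')] at hx'
    have hyz := crossing (u := z) (v := y)
    have hyw := crossing (u := w) (v := y)
    have hzw := crossing (u := z) (v := w)
    have hwz := crossing (u := w) (v := z)
    have htri := hT.connected.dist_triangle (u := z) (v := x) (w := w)
    have hz := hT.dist_eq_dist_add_one_of_adj z hadj
    have hw := hT.dist_eq_dist_add_one_of_adj w hadj
    rw [T.dist_comm (u := w) (v := z)] at hwz
    rw [T.dist_comm (u := x) (v := w)] at htri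
    rw [T.dist_comm (u := x') (v := z), T.dist_comm (u := x') (v := w),
      T.dist_comm (u := y) (v := z), T.dist_comm (u := y) (v := w)] at hih
    rw [T.dist_comm (u := x) (v := z), T.dist_comm (u := x) (v := w),
      T.dist_comm (u := y) (v := z), T.dist_comm (u := y) (v := w)]
    rw [T.dist_comm (u := x) (v := y)] at hd
    lia

/-- A vertex on a geodesic of a tree is determined by its distances to the endpoints. -/
lemma IsTree.eq_of_dist_add_dist_le (hT : T.IsTree) {u v w w' : V}
    (h : T.dist u w + T.dist w v ≤ T.dist u v) (h₁ : T.dist u w' ≤ T.dist u w)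
    (h₂ : T.dist w' v ≤ T.dist w v) : w = w' := by
  apply hT.connected.dist_eq_zero_iff.mp
  have := hT.dist_add_dist_le u v w w'
  rw [T.dist_comm (u := v), T.dist_comm (u := v)] at this
  lia

variable [Group G] [MulAction G V]

lemma Connected.dist_smul_smul (hT : T.Connected)
    (hact : ∀ (g : G) (u v : V), T.Adj u v → T.Adj (g • u) (g • v)) (g : G) (u v : V) :
    T.dist (g • u) (g • v) = T.dist u v := by
  have hle (g : G) (u v : V) : T.dist (g • u) (g • v) ≤ T.dist u v := by
    obtain ⟨p, hp⟩ := hT.exists_walk_length_eq_dist u v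
    let f : T →g T := ⟨(g • ·), fun h => hact g _ _ h⟩
    rw [← hp, ← Walk.length_map f p]
    exact dist_le (p.map f)
  refine (hle g u v).antisymm ?_
  simpa using hle g⁻¹ (g • u) (g • v)

lemma Connected.dist_pow_smul_pow_smul (hT : T.Connected)
    (hact : ∀ (g : G) (u v : V), T.Adj u v → T.Adj (g • u) (g • v)) (g : G) (x : V) (i j : ℕ) :
    T.dist (g ^ i • x) (g ^ (i + j) • x) = T.dist x (g ^ j • x) := by
  rw [pow_add, mul_smul, hT.dist_smul_smul hact]

lemma Connected.dist_pow_smul_le (hT : T.Connected)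
    (hact : ∀ (g : G) (u v : V), T.Adj u v → T.Adj (g • u) (g • v)) (g : G) (x : V) (i : ℕ) :
    T.dist x (g ^ i • x) ≤ i * T.dist x (g • x) := by
  induction i with
  | zero => simp
  | succ i ih =>
    have h1 := hT.dist_triangle (u := x) (v := g ^ i • x) (w := g ^ (i + 1) • x)
    rw [hT.dist_pow_smul_pow_smul hact, pow_one] at h1
    lia

/-- A vertex displaced minimally by a loxodromic element lies on its axis. -/
lemma IsTree.dist_pow_smul_of_forall_le (hT : T.IsTree)
    (hact : ∀ (g : G) (u v : V), T.Adj u v → T.Adj (g • u) (g • v)) {a : G}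
    (hnofix : ∀ v : V, a • v ≠ v)
    (hnoinv : ∀ u v : V, T.Adj u v → ¬(a • u = v ∧ a • v = u)) {x : V}
    (hx : ∀ v, T.dist x (a • x) ≤ T.dist v (a • v)) (i : ℕ) :
    T.dist x (a ^ i • x) = i * T.dist x (a • x) := by
  have hC := hT.connected
  have hD : T.dist (a • x) (a • a • x) = T.dist x (a • x) := hC.dist_smul_smul hact a _ _
  have hpos := hC.pos_dist_of_ne (hnofix x).symm
  obtain ⟨y, hadj, hy⟩ := hC.exists_adj_dist_add_one (hnofix x)
  have hadj1 := dist_eq_one_iff_adj.mpr hadj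
  rw [T.dist_comm (v := x), T.dist_comm (v := x)] at hy
  have hsq : 2 * T.dist x (a • x) ≤ T.dist x (a • a • x) := by
    rcases hT.dist_eq_dist_add_one_of_adj (a • a • x) hadj with hback | hfwd
    · exfalso
      have h1 : T.dist (a • x) (a⁻¹ • y) = T.dist (a • a • x) y := by
        rw [← hC.dist_smul_smul hact a, smul_inv_smul]
      have h2 : T.dist x (a⁻¹ • y) = 1 := by
        rw [← hC.dist_smul_smul hact a, smul_inv_smul, hadj1]
      rw [T.dist_comm (v := a • x)] at hback
      have h3 := hx (a⁻¹ • y)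
      rw [smul_inv_smul] at h3
      rcases Nat.lt_or_ge (T.dist x (a • x)) 2 with hl | hl
      · have hxy : x = y := hC.dist_eq_zero_iff.mp (by lia)
        subst hxy
        have h4 : a • x = a⁻¹ • x := hC.dist_eq_zero_iff.mp (by lia)
        exact hnoinv x (a • x) hadj.symm ⟨rfl, by rw [h4, smul_inv_smul]⟩
      · have h5 := hT.dist_add_dist_le x (a • x) y (a⁻¹ • y)
        rw [T.dist_comm (u := y)] at h5
        lia
    · have h1 := hT.dist_add_dist_le x (a • x) y (a • a • x)
      rw [T.dist_comm (u := a • a • x), T.dist_comm (u := a • a • x)] at hfwd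
      lia
  have hstep (i : ℕ) : T.dist x (a ^ i • x) = i * T.dist x (a • x) ∧
      T.dist x (a ^ (i + 1) • x) = (i + 1) * T.dist x (a • x) := by
    induction i with
    | zero => simp
    | succ i ih =>
      refine ⟨by simpa using ih.2, ?_⟩
      have h1 := hT.dist_add_dist_le x (a ^ (i + 1) • x) (a ^ i • x) (a ^ (i + 2) • x)
      have h2 := hC.dist_pow_smul_pow_smul hact a x i 2
      have h3 := hC.dist_pow_smul_pow_smul hact a x (i + 1) 1
      have h4 := hC.dist_pow_smul_pow_smul hact a x i 1
      have h5 := hC.dist_pow_smul_le hact a x (i + 2)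
      rw [pow_two, mul_smul] at h2
      rw [pow_one] at h3 h4
      rw [T.dist_comm (u := a ^ (i + 1) • x) (v := a ^ i • x), h2, h3, h4, ih.1, ih.2] at h1
      refine h5.antisymm ?_
      rcases h1 with h1 | h1 <;> nlinarith
  exact (hstep i).1

/-- On the axis of `b ^ m`, the displacement of `b` is the one of `b ^ m` divided by `m`. -/
lemma IsTree.mul_dist_smul_eq (hT : T.IsTree)
    (hact : ∀ (g : G) (u v : V), T.Adj u v → T.Adj (g • u) (g • v)) {b : G} {m l : ℕ}
    (hm : 0 < m) (hl : 0 < l) {x : V} (hx : ∀ i : ℕ, T.dist x ((b ^ m) ^ i • x) = i * l) :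
    m * T.dist x (b • x) = l := by
  have hC := hT.connected
  have hlow (i : ℕ) : i * l ≤ m * T.dist x (b ^ i • x) := by
    rw [← hx i, ← pow_mul, mul_comm m i, pow_mul]
    exact hC.dist_pow_smul_le hact (b ^ i) x m
  refine le_antisymm ?_ (by simpa using hlow 1)
  obtain ⟨N, hN⟩ : ∃ N, N = T.dist x (b • x) + 1 := ⟨_, rfl⟩
  obtain ⟨j, hj⟩ : ∃ j, m * N = j + 1 := Nat.exists_eq_add_one.mpr (Nat.mul_pos hm (by lia))
  have hfj : T.dist x (b ^ (j + 1) • x) = N * l := by rw [← hj, pow_mul, hx]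
  have hf2j : T.dist x (b ^ (j + 1 + (j + 1)) • x) = 2 * (N * l) := by
    rw [← hj, ← mul_add, pow_mul, hx]
    ring
  have hNl : T.dist x (b • x) ≤ N * l := by nlinarith
  have hsum : T.dist x (b ^ (j + 2) • x) + T.dist x (b ^ j • x) ≤ 2 * (N * l) := by
    have h := hT.dist_add_dist_le x (b ^ (j + 2) • x) (b ^ 1 • x) (b ^ (1 + j) • x)
    have h1 := hC.dist_pow_smul_pow_smul hact b x 1 j
    have h2 := hC.dist_pow_smul_pow_smul hact b x 1 (j + 1)
    have h3 := hC.dist_pow_smul_pow_smul hact b x (j + 1) 1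
    rw [show 1 + (j + 1) = j + 2 by ring] at h2
    rw [show 1 + j = j + 1 by ring] at h h1
    rw [show j + 1 + 1 = j + 2 by ring] at h3
    rw [T.dist_comm (u := b ^ (j + 2) • x), T.dist_comm (u := b ^ (j + 2) • x), h1, h2, h3, hfj]
      at h
    rw [pow_one] at h
    lia
  have hmain : T.dist x (b • x) + N * l ≤ T.dist x (b ^ j • x) ∨
      T.dist x (b • x) + N * l ≤ T.dist x (b ^ (j + 2) • x) := by
    have h := hT.dist_add_dist_le (b ^ (j + 1) • x) (b ^ (j + 1 + 1) • x) x
      (b ^ (j + 1 + (j + 1)) • x)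
    have h1 := hC.dist_pow_smul_pow_smul hact b x (j + 1) 1
    have h2 := hC.dist_pow_smul_pow_smul hact b x (j + 1) (j + 1)
    have h3 := hC.dist_pow_smul_pow_smul hact b x (j + 1 + 1) j
    rw [show j + 1 + 1 + j = j + 1 + (j + 1) by ring] at h3
    rw [T.dist_comm (v := x), T.dist_comm (v := x), h1, h2, h3, hf2j, hfj, pow_one] at h
    rw [show j + 1 + 1 = j + 2 by ring] at h
    lia
  have hlow1 := hlow j
  have hlow2 := hlow (j + 2)
  have hjl : m * (N * l) = j * l + l := by rw [← mul_assoc, hj]; ring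
  have hsum' := Nat.mul_le_mul_left m hsum
  rcases hmain with h | h
  · have h' := Nat.mul_le_mul_left m h
    nlinarith
  · have h' := Nat.mul_le_mul_left m h
    nlinarith

/-- Two `m`-th roots of a loxodromic element agree on its axis. -/
lemma IsTree.smul_eq_smul_of_pow_eq (hT : T.IsTree)
    (hact : ∀ (g : G) (u v : V), T.Adj u v → T.Adj (g • u) (g • v)) {a b c : G} {m l : ℕ}
    (hm : 0 < m) (hl : 0 < l) (hb : b ^ m = a) (hc : c ^ m = a) {x : V}
    (hx : ∀ i : ℕ, T.dist x (a ^ i • x) = i * l) : b • x = c • x := by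
  have hC := hT.connected
  have root {g : G} (hg : g ^ m = a) : m * T.dist x (g • x) = l ∧
      T.dist (g • x) (a • x) ≤ (m - 1) * T.dist x (g • x) := by
    refine ⟨hT.mul_dist_smul_eq hact hm hl (by simpa only [hg] using hx), ?_⟩
    have h := hC.dist_pow_smul_pow_smul hact g x 1 (m - 1)
    rw [show 1 + (m - 1) = m by lia, hg, pow_one] at h
    rw [h]
    exact hC.dist_pow_smul_le hact g x (m - 1)
  obtain ⟨hb1, hb2⟩ := root hb
  obtain ⟨hc1, hc2⟩ := root hc
  have hbc : T.dist x (c • x) = T.dist x (b • x) :=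
    Nat.eq_of_mul_eq_mul_left hm (hc1.trans hb1.symm)
  rw [hbc] at hc2
  have hxa : T.dist x (a • x) = l := by simpa using hx 1
  have htri := hC.dist_triangle (u := x) (v := b • x) (w := a • x)
  obtain ⟨k, rfl⟩ := Nat.exists_eq_add_one.mpr hm
  rw [Nat.add_sub_cancel] at hb2 hc2
  rw [add_mul, one_mul] at hb1
  exact hT.eq_of_dist_add_dist_le (u := x) (v := a • x) (by lia) hbc.le (by lia)

lemma IsTree.smul_eq_smul_of_zpow_eq (hT : T.IsTree)
    (hact : ∀ (g : G) (u v : V), T.Adj u v → T.Adj (g • u) (g • v)) {a b c : G} {m : ℤ} {l : ℕ}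
    (hm : m ≠ 0) (hl : 0 < l) (hb : b ^ m = a) (hc : c ^ m = a) {x : V}
    (hx : ∀ i : ℕ, T.dist x (a ^ i • x) = i * l) : b • x = c • x := by
  obtain ⟨k, rfl | rfl⟩ := m.eq_nat_or_neg
  · rw [zpow_natCast] at hb hc
    exact hT.smul_eq_smul_of_pow_eq hact (by lia) hl hb hc hx
  · rw [zpow_neg, zpow_natCast, inv_eq_iff_eq_inv] at hb hc
    refine hT.smul_eq_smul_of_pow_eq hact (by lia) hl hb hc fun i => ?_
    rw [← hx i, ← hT.connected.dist_smul_smul hact (a ^ i), inv_pow, smul_inv_smul, T.dist_comm]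

end SimpleGraph

/-- If a group `G` acts `(k,n)`-acylindrically on a simplicial tree `T`
(pointwise stabilizers of segments of length `k` have at most `n` elements), then for any
loxodromic `a ∈ G` (no fixed vertex and no inverted edge) and any nonzero integer `m`,
there are at most `n` elements `b ∈ G` with `a = b^m`. -/
theorem roots_of_loxodromic_bound {V G : Type*} [Group G] [MulAction G V]
    (T : SimpleGraph V) (hT : T.IsTree)
    (hact : ∀ (g : G) (u v : V), T.Adj u v → T.Adj (g • u) (g • v))
    (k n : ℕ)
    (hacyl : ∀ (u v : V) (p : T.Walk u v), p.IsPath → p.length = k →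
      {g : G | ∀ w ∈ p.support, g • w = w}.Finite ∧
        {g : G | ∀ w ∈ p.support, g • w = w}.ncard ≤ n)
    (a : G) (hnofix : ∀ v : V, a • v ≠ v)
    (hnoinv : ∀ u v : V, T.Adj u v → ¬(a • u = v ∧ a • v = u))
    (m : ℤ) (hm : m ≠ 0) :
    {b : G | b ^ m = a}.Finite ∧ {b : G | b ^ m = a}.ncard ≤ n := by
  have hC := hT.connected
  have := hC.nonempty
  obtain ⟨x, hx⟩ : ∃ x, ∀ v, T.dist x (a • x) ≤ T.dist v (a • v) := by
    refine ⟨Function.argmin (fun v => T.dist v (a • v)), fun v => ?_⟩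
    exact Function.argmin_le (fun v => T.dist v (a • v)) v
  have hpos := hC.pos_dist_of_ne (hnofix x).symm
  have haxis := hT.dist_pow_smul_of_forall_le hact hnofix hnoinv hx
  obtain ⟨p, hp, hlen⟩ := hC.exists_path_of_dist x (a ^ k • x)
  obtain ⟨hfin, hcard⟩ := hacyl _ _ (p.take k) (hp.take k) (by
    rw [SimpleGraph.Walk.take_length, hlen, haxis]
    exact min_eq_left (Nat.le_mul_of_pos_right k hpos))
  rcases Set.eq_empty_or_nonempty {b : G | b ^ m = a} with hempty | ⟨c, hc : c ^ m = a⟩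
  · simp [hempty]
  have hmaps : ∀ b ∈ {b : G | b ^ m = a},
      c⁻¹ * b ∈ {g : G | ∀ w ∈ (p.take k).support, g • w = w} := by
    intro b (hb : b ^ m = a) w hw
    have hw' : w ∈ p.support := by
      rw [SimpleGraph.Walk.support_take] at hw
      exact List.mem_of_mem_take hw
    have hcomm : Commute (c⁻¹ * b) (a ^ k) :=
      (((hc ▸ Commute.self_zpow c m : Commute c a).inv_left).mul_left
        (hb ▸ Commute.self_zpow b m)).pow_right k
    have hfix : (c⁻¹ * b) • x = x := by
      rw [mul_smul, hT.smul_eq_smul_of_zpow_eq hact hm hpos hb hc haxis, inv_smul_smul]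
    have hfix' : (c⁻¹ * b) • a ^ k • x = a ^ k • x := by
      rw [← mul_smul, hcomm.eq, mul_smul, hfix]
    have h1 := hC.dist_smul_smul hact (c⁻¹ * b) x w
    have h2 := hC.dist_smul_smul hact (c⁻¹ * b) w (a ^ k • x)
    rw [hfix] at h1
    rw [hfix'] at h2
    exact (hT.eq_of_dist_add_dist_le (hT.dist_add_dist_of_mem_support hp hw').le
      h1.le h2.le).symm
  have hinj : Set.InjOn (c⁻¹ * ·) {b : G | b ^ m = a} := (mul_right_injective c⁻¹).injOn
  exact ⟨Set.Finite.of_injOn hmaps hinj hfin,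
    (Set.ncard_le_ncard_of_injOn _ hmaps hinj hfin).trans hcard⟩
end

section
/- Let G be a group acting coboundedly and acylindrically on a hyperbolic geodesic space S. Then there exists a constant C₀ ∈ ℕ such that for any two loxodromic elements a, b ∈ G with E_G(a) ≠ E_G(b) and any integers n, m ≥ C₀, the product a^n b^m is loxodromic. -/
/-- A unit-speed geodesic parametrization from `x` to `y`. -/
def IsGeodesicSegment {S : Type*} [MetricSpace S] (f : ℝ → S) (x y : S) : Prop :=
  f 0 = x ∧ f (dist x y) = y ∧
    ∀ a ∈ Set.Icc (0:ℝ) (dist x y), ∀ b ∈ Set.Icc (0:ℝ) (dist x y), dist (f a) (f b) = |a - b|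

/-- A metric space is geodesic if any two points are joined by a geodesic. -/
def GeodesicSpace (S : Type*) [MetricSpace S] : Prop :=
  ∀ x y : S, ∃ f : ℝ → S, IsGeodesicSegment f x y

/-- The Gromov product `(x,y)_z`. -/
noncomputable def GromovProd {S : Type*} [MetricSpace S] (x y z : S) : ℝ :=
  (dist z x + dist z y - dist x y) / 2

/-- Every geodesic triangle is `δ`-thin at each of its vertices. -/
def ThinTriangles (δ : ℝ) (S : Type*) [MetricSpace S] : Prop :=
  ∀ (A B C : S) (f g : ℝ → S), IsGeodesicSegment f C A → IsGeodesicSegment g C B →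
    ∀ t ∈ Set.Icc (0:ℝ) (GromovProd A B C), dist (f t) (g t) ≤ δ

/-- A `δ`-hyperbolic space: geodesic, with all triangles `δ`-thin at the vertices. -/
def DeltaHyperbolic (δ : ℝ) (S : Type*) [MetricSpace S] : Prop :=
  GeodesicSpace S ∧ ThinTriangles δ S

/-- The group `G` acts on `S` by isometries. -/
def IsometricAction (G S : Type*) [Group G] [MulAction G S] [MetricSpace S] : Prop :=
  ∀ g : G, Isometry fun t : S => g • t

/-- The action of `G` on `S` is cobounded: `S = G · B` for some bounded `B`. -/
def CoboundedAction (G S : Type*) [Group G] [MulAction G S] [MetricSpace S] : Prop :=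
  ∃ B : Set S, Bornology.IsBounded B ∧ ∀ t : S, ∃ g : G, ∃ b ∈ B, t = g • b

/-- Bowditch's acylindricity condition for the action of `G` on `S`. -/
def AcylindricalAction (G S : Type*) [Group G] [MulAction G S] [MetricSpace S] : Prop :=
  ∀ ε : ℝ, 0 < ε → ∃ R : ℝ, ∃ N : ℕ, 0 < R ∧ ∀ p q : S, R ≤ dist p q →
    {g : G | dist p (g • p) ≤ ε ∧ dist q (g • q) ≤ ε}.Finite ∧
    {g : G | dist p (g • p) ≤ ε ∧ dist q (g • q) ≤ ε}.ncard ≤ N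

/-- `g` is elliptic: the orbits of `⟨g⟩` are bounded. -/
def IsEllipticElt {G : Type*} (S : Type*) [Group G] [MulAction G S] [MetricSpace S]
    (g : G) : Prop :=
  ∀ s : S, Bornology.IsBounded (Set.range fun n : ℤ => (g ^ n) • s)

/-- `g` is loxodromic: `n ↦ gⁿ • s` is a quasi-isometric embedding of `ℤ`. -/
def IsLoxodromicElt {G : Type*} (S : Type*) [Group G] [MulAction G S] [MetricSpace S]
    (g : G) : Prop :=
  ∃ s : S, ∃ κ ε : ℝ, 1 ≤ κ ∧ 0 ≤ ε ∧
    ∀ n m : ℤ, |(n : ℝ) - (m : ℝ)| / κ - ε ≤ dist ((g ^ n) • s) ((g ^ m) • s)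

/-- The elementary subgroup `E_G(g) = {f | ∃ n ≥ 1, f⁻¹ gⁿ f = g^{±n}}` associated with a
loxodromic element `g`, as a subset of `G`. -/
def ElemSubset {G : Type*} [Group G] (g : G) : Set G :=
  {f | ∃ n : ℕ, 0 < n ∧ (f⁻¹ * g ^ n * f = g ^ n ∨ f⁻¹ * g ^ n * f = (g ^ n)⁻¹)}

open Filter Topology

/-- Gromov's four-point inequality with additive constant `D`. -/
def FourPoint (D : ℝ) (S : Type*) [MetricSpace S] : Prop :=
  ∀ x y z w : S, dist x z + dist y w ≤ dist x y + dist z w + D ∨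
    dist x z + dist y w ≤ dist y z + dist x w + D

/-- Any two points are joined by a metric segment. -/
def HasSegments (S : Type*) [MetricSpace S] : Prop :=
  ∀ x y : S, ∀ t : ℝ, 0 ≤ t → t ≤ dist x y → ∃ w, dist x w = t ∧ dist w y = dist x y - t

/-- The point `w` lies between `x` and `y`, up to the additive error `E`. -/
def RoughBtw {S : Type*} [MetricSpace S] (E : ℝ) (x w y : S) : Prop :=
  dist x w + dist w y ≤ dist x y + E

section Geometry

variable {S : Type*} [MetricSpace S] {D E F : ℝ}

theorem ThinTriangles.fourPoint {δ : ℝ} (hg : GeodesicSpace S) (hthin : ThinTriangles δ S)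
    (hD : 2 * δ ≤ D) : FourPoint D S := by
  intro x y z w
  obtain ⟨f, hf⟩ := hg w x
  obtain ⟨g, hgy⟩ := hg w y
  obtain ⟨h, hh⟩ := hg w z
  have t1 := dist_triangle w x y
  have t2 := dist_triangle w y x
  have t3 := dist_triangle w y z
  have t4 := dist_triangle w z y
  have t5 := dist_triangle x w y
  have t6 := dist_triangle y w z
  have c1 := dist_comm x y
  have c2 := dist_comm y z
  have c3 := dist_comm w x
  have c4 := dist_comm w y
  have c5 := dist_comm w z
  set t := min (GromovProd x y w) (GromovProd y z w) with ht
  have htx : t ≤ GromovProd x y w := min_le_left _ _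
  have hty : t ≤ GromovProd y z w := min_le_right _ _
  have ht0 : 0 ≤ t := by
    refine le_min ?_ ?_ <;> unfold GromovProd <;> linarith
  have h1 := hthin x y w f g hf hgy t ⟨ht0, htx⟩
  have h2 := hthin y z w g h hgy hh t ⟨ht0, hty⟩
  have hx1 : t ≤ dist w x := by unfold GromovProd at htx; linarith
  have hz1 : t ≤ dist w z := by unfold GromovProd at hty; linarith
  have h3 := hf.2.2 t ⟨ht0, hx1⟩ (dist w x) ⟨dist_nonneg, le_rfl⟩
  have h4 := hh.2.2 t ⟨ht0, hz1⟩ (dist w z) ⟨dist_nonneg, le_rfl⟩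
  rw [hf.2.1, abs_sub_comm, abs_of_nonneg (by linarith)] at h3
  rw [hh.2.1, abs_sub_comm, abs_of_nonneg (by linarith)] at h4
  have t7 := dist_triangle x (f t) z
  have t8 := dist_triangle (f t) (h t) z
  have t9 := dist_triangle (f t) (g t) (h t)
  have c6 := dist_comm x (f t)
  rcases min_choice (GromovProd x y w) (GromovProd y z w) with hm | hm
  · left
    rw [← ht] at hm
    unfold GromovProd at hm
    linarith
  · right
    rw [← ht] at hm
    unfold GromovProd at hm
    linarith

theorem GeodesicSpace.hasSegments (hg : GeodesicSpace S) : HasSegments S := by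
  intro x y t h0 h1
  obtain ⟨f, hf0, hf1, hf⟩ := hg x y
  refine ⟨f t, ?_, ?_⟩
  · have := hf 0 ⟨le_rfl, dist_nonneg⟩ t ⟨h0, h1⟩
    rw [hf0, zero_sub, abs_neg, abs_of_nonneg h0] at this
    exact this
  · have := hf t ⟨h0, h1⟩ (dist x y) ⟨dist_nonneg, le_rfl⟩
    rw [hf1, abs_sub_comm, abs_of_nonneg (by linarith)] at this
    exact this

theorem RoughBtw.mono {x w y : S} (h : RoughBtw E x w y) (hEF : E ≤ F) : RoughBtw F x w y := by
  unfold RoughBtw at *; linarith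

theorem RoughBtw.symm {x w y : S} (h : RoughBtw E x w y) : RoughBtw E y w x := by
  unfold RoughBtw at *
  rw [dist_comm y w, dist_comm w x, dist_comm y x]; linarith

theorem RoughBtw.of_dist_le {x w w' y : S} {c : ℝ} (h : RoughBtw E x w y) (hc : dist w w' ≤ c) :
    RoughBtw (E + 2 * c) x w' y := by
  unfold RoughBtw at *
  have h1 := dist_triangle x w w'
  have h2 := dist_triangle w' w y
  rw [dist_comm w' w] at h2
  linarith

/-- Two points lying between `P` and `Q` are as far apart as their distances to `P` tell. -/
theorem RoughBtw.dist_le (hD : FourPoint D S) {P Q u v : S} (hu : RoughBtw E P u Q)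
    (hv : RoughBtw E P v Q) : dist u v ≤ |dist P u - dist P v| + E + D := by
  unfold RoughBtw at *
  have c1 := dist_comm u P
  have c2 := dist_comm v P
  have a1 := le_abs_self (dist P u - dist P v)
  have a2 := neg_le_abs (dist P u - dist P v)
  rcases hD u P v Q with h | h <;> linarith [dist_comm P v]

theorem RoughBtw.trans_between (hD : FourPoint D S) {P Q u v w : S} (hu : RoughBtw E P u Q)
    (hv : RoughBtw E P v Q) (hw : RoughBtw F u w v) : RoughBtw (E + 2 * F + 2 * D) P w Q := by
  unfold RoughBtw at *
  have c1 := dist_comm w u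
  have t1 := dist_triangle P u v
  have t2 := dist_triangle u v Q
  have t3 := dist_triangle P v u
  have t4 := dist_triangle v u Q
  have c2 := dist_comm u v
  rcases hD P u w v with h | h <;> rcases hD w u Q v with h' | h' <;>
    linarith [dist_comm u Q, dist_comm Q v, dist_comm w v, dist_nonneg (x := u) (y := w),
      dist_nonneg (x := w) (y := v), dist_triangle u w v]

theorem RoughBtw.chain (hD : FourPoint D S) (hD0 : 0 ≤ D) {y u v z : S}
    (h1 : RoughBtw E y u v) (h2 : RoughBtw E u v z) (h : E + D < dist u v) :
    dist y u + dist u v + dist v z ≤ dist y z + (2 * E + D) := by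
  unfold RoughBtw at *
  have t1 := dist_triangle y u v
  rcases hD y u v z with h' | h' <;> linarith

/-- A point on a segment far from its endpoints is close to any line passing near both
endpoints, with an error that does not depend on how near. -/
theorem RoughBtw.between_of_far (hD : FourPoint D S) (h0 : 0 ≤ D) (h0E : 0 ≤ E) {P Q P' Q' w : S}
    (hw : RoughBtw 0 P w Q) (hP : RoughBtw E P' P Q') (hQ : RoughBtw E P' Q Q')
    (hPw : 2 * E + 4 * D < dist P w) (hQw : 2 * E + 4 * D < dist w Q) :
    RoughBtw (4 * D) P' w Q' := by
  unfold RoughBtw at *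
  have c1 := dist_comm P P'
  have c2 := dist_comm Q P'
  have c3 := dist_comm w P'
  have c4 := dist_comm Q w
  have c5 := dist_comm Q' P'
  have c6 := dist_comm P w
  have c7 := dist_comm P Q
  have t1 := dist_triangle P' P w
  have t2 := dist_triangle P' Q w
  have t3 := dist_triangle P w Q
  have t4 := dist_triangle P' w Q'
  have t5 := dist_triangle w P Q'
  have t6 := dist_triangle w Q Q'
  rcases hD P P' Q Q' with h | h <;> rcases hD w P P' Q with h' | h' <;>
    rcases hD w P Q' Q with h'' | h'' <;> try linarith [dist_comm P Q', dist_comm Q Q']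
  all_goals
    rcases hD P' w Q Q' with h3 | h3 <;> rcases hD P' w P Q' with h4 | h4 <;>
     linarith [dist_comm P Q', dist_comm Q Q',dist_comm w Q]

end Geometry

section Axis

variable {G S : Type*} [MetricSpace S] [Group G] [MulAction G S] {D E F : ℝ}

/-- The point `w` lies, up to the error `E`, between the far ends of the negative and the positive
half-orbits of `b`. -/
def InAxis (E : ℝ) (b : G) (w : S) : Prop :=
  ∀ z z' : S, ∀ᶠ q : ℕ × ℕ in atTop,
    RoughBtw E ((b ^ (-(q.1 : ℤ))) • z) w ((b ^ (q.2 : ℤ)) • z')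

theorem InAxis.mono {b : G} {w : S} (h : InAxis E b w) (hEF : E ≤ F) : InAxis F b w :=
  fun z z' => (h z z').mono fun _ hq => hq.mono hEF

theorem InAxis.of_dist_le {b : G} {w w' : S} {c : ℝ} (h : InAxis E b w) (hc : dist w w' ≤ c) :
    InAxis (E + 2 * c) b w' :=
  fun z z' => (h z z').mono fun _ hq => hq.of_dist_le hc

theorem InAxis.of_between (hD : FourPoint D S) {b : G} {u v w : S} (hu : InAxis E b u)
    (hv : InAxis E b v) (hw : RoughBtw F u w v) : InAxis (E + 2 * F + 2 * D) b w := by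
  intro z z'
  filter_upwards [hu z z', hv z z'] with q h1 h2
  exact RoughBtw.trans_between hD h1 h2 hw

theorem IsLoxodromicElt.pow {b : G} (hb : IsLoxodromicElt S b) {k : ℕ} (hk : 0 < k) :
    IsLoxodromicElt S (b ^ k) := by
  obtain ⟨s, κ, ε, hκ, hε, h⟩ := hb
  refine ⟨s, κ, ε, hκ, hε, fun n m => ?_⟩
  have h1 := h (k * n) (k * m)
  rw [← zpow_natCast, ← zpow_mul, ← zpow_mul]
  refine le_trans ?_ h1
  have hk1 : (1 : ℝ) ≤ k := by exact_mod_cast hk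
  push_cast
  rw [← mul_sub, abs_mul, Nat.abs_cast]
  have : |(n : ℝ) - m| / κ ≤ k * |(n : ℝ) - m| / κ := by
    gcongr
    nlinarith [abs_nonneg ((n : ℝ) - m)]
  linarith

theorem IsLoxodromicElt.inv {b : G} (hb : IsLoxodromicElt S b) : IsLoxodromicElt S b⁻¹ := by
  obtain ⟨s, κ, ε, hκ, hε, h⟩ := hb
  refine ⟨s, κ, ε, hκ, hε, fun n m => ?_⟩
  have h1 := h (-n) (-m)
  rw [inv_zpow', inv_zpow']
  refine le_trans (le_of_eq ?_) h1
  push_cast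
  rw [neg_sub_neg, abs_sub_comm]

variable [IsIsometricSMul G S]

theorem roughBtw_smul_iff (g : G) {x w y : S} :
    RoughBtw E (g • x) (g • w) (g • y) ↔ RoughBtw E x w y := by
  unfold RoughBtw
  simp only [dist_smul]

theorem InAxis.smul_of_commute {b h : G} {w : S} (hw : InAxis E b w) (hc : Commute h b) :
    InAxis E b (h • w) := by
  intro z z'
  filter_upwards [hw (h⁻¹ • z) (h⁻¹ • z')] with q hq
  rw [← roughBtw_smul_iff h] at hq
  simp only [smul_smul] at hq
  rwa [← mul_assoc, ← mul_assoc, (hc.zpow_right _).eq, (hc.zpow_right _).eq, mul_assoc, mul_assoc,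
    mul_inv_cancel, mul_one, mul_one] at hq

theorem InAxis.zpow_smul {b : G} {w : S} (hw : InAxis E b w) (k : ℤ) :
    InAxis E b ((b ^ k) • w) :=
  hw.smul_of_commute ((Commute.refl b).zpow_left k)

theorem dist_zpow_smul_zpow_smul (b : G) (i j : ℤ) (s : S) :
    dist ((b ^ i) • s) ((b ^ j) • s) = dist ((b ^ (i - j)) • s) s := by
  rw [← dist_smul (b ^ j) ((b ^ (i - j)) • s) s, smul_smul, ← zpow_add]
  congr 3; ring

theorem dist_zpow_smul_self_neg (b : G) (i : ℤ) (s : S) :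
    dist ((b ^ (-i)) • s) s = dist ((b ^ i) • s) s := by
  have h := dist_zpow_smul_zpow_smul b 0 i s
  rw [zero_sub, zpow_zero, one_smul, dist_comm] at h
  exact h.symm

/-- The orbits of a loxodromic element tend to infinity. -/
theorem IsLoxodromicElt.eventually_far {b : G} (hb : IsLoxodromicElt S b) (z w : S) (R : ℝ) :
    ∀ᶠ i : ℕ in atTop, R ≤ dist ((b ^ (i : ℤ)) • z) w ∧ R ≤ dist ((b ^ (-(i : ℤ))) • z) w := by
  obtain ⟨s, κ, ε, hκ, hε, h⟩ := hb
  have hκ0 : 0 < κ := by linarith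
  obtain ⟨n, hn⟩ := exists_nat_ge ((R + ε + 2 * dist s z + dist s w) * κ)
  have hgen : ∀ i : ℤ, R + 2 * dist s z + dist s w ≤ dist ((b ^ i) • s) s →
      R ≤ dist ((b ^ i) • z) w := by
    intro i hi
    have t1 := dist_triangle ((b ^ i) • s) ((b ^ i) • z) s
    have t2 := dist_triangle ((b ^ i) • z) w s
    rw [dist_smul] at t1
    linarith [dist_comm w s, dist_nonneg (x := s) (y := z)]
  filter_upwards [eventually_ge_atTop n] with i hi
  have hni : (n : ℝ) ≤ i := by exact_mod_cast hi
  have key : R + 2 * dist s z + dist s w ≤ dist ((b ^ (i : ℤ)) • s) s := by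
    have h1 := h i 0
    rw [zpow_zero, one_smul] at h1
    simp only [Int.cast_natCast, Int.cast_zero, sub_zero, Nat.abs_cast] at h1
    have : R + ε + 2 * dist s z + dist s w ≤ (i : ℝ) / κ := by
      rw [le_div_iff₀ hκ0]; linarith
    linarith
  refine ⟨hgen _ key, hgen _ ?_⟩
  rw [dist_zpow_smul_self_neg]; exact key

theorem IsLoxodromicElt.zpow_injective {b : G} (hb : IsLoxodromicElt S b) :
    Function.Injective fun i : ℤ => b ^ i := by
  rw [injective_zpow_iff_not_isOfFinOrder]
  intro hfin
  obtain ⟨s, -⟩ := id hb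
  obtain ⟨k, hk, hbk⟩ := isOfFinOrder_iff_pow_eq_one.1 hfin
  obtain ⟨n, hn⟩ := eventually_atTop.1 (hb.eventually_far s s 1)
  have h1 := (hn (k * n) (Nat.le_mul_of_pos_left n hk)).1
  rw [zpow_natCast, pow_mul, hbk, one_pow, one_smul, dist_self] at h1
  linarith

/-- If `b` moves `x` along a line, at least up to an amount depending on `x`, then some axis of `b`
contains `x`. -/
theorem IsLoxodromicElt.inAxis_of_roughBtw (hD : FourPoint D S) (hD0 : 0 ≤ D) {b : G}
    (hb : IsLoxodromicElt S b) {x : S}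
    (h : ∀ i j : ℕ, RoughBtw E ((b ^ (-(i : ℤ))) • x) x ((b ^ (j : ℤ)) • x)) :
    InAxis (E + 2 * D) b x := by
  intro z z'
  have e1 := hb.eventually_far x x (E + 2 * D + 1 + dist x z + dist x z')
  rw [← prod_atTop_atTop_eq]
  filter_upwards [prod_mem_prod e1 e1] with q hq
  have f1 := hq.1.2
  have f2 := hq.2.1
  have hij := h q.1 q.2
  have hE : 0 ≤ E := by simpa [RoughBtw] using h 0 0
  have d1 := dist_smul (b ^ (-(q.1 : ℤ))) x z
  have d2 := dist_smul (b ^ (q.2 : ℤ)) x z'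
  set P := (b ^ (-(q.1 : ℤ))) • x
  set Q := (b ^ (q.2 : ℤ)) • x
  set P' := (b ^ (-(q.1 : ℤ))) • z
  set Q' := (b ^ (q.2 : ℤ)) • z'
  unfold RoughBtw at *
  have c1 := dist_comm P x
  have c2 := dist_comm Q x
  have c3 := dist_comm P' x
  have c4 := dist_comm Q' x
  have c5 := dist_comm P P'
  have c6 := dist_comm Q Q'
  have t1 := dist_triangle x Q' Q
  have t2 := dist_triangle x P' P
  have t3 := dist_triangle x Q Q'
  have t4 := dist_triangle x P P'
  have t5 := dist_triangle P P' Q'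
  have p1 := dist_nonneg (x := x) (y := z)
  have p2 := dist_nonneg (x := x) (y := z')
  rcases hD P x Q Q' with h1 | h1 <;> rcases hD P x Q' P' with h2 | h2 <;>
    linarith [dist_comm P Q', dist_comm P' Q', dist_comm P Q]

end Axis

section Existence

variable {G S : Type*} [MetricSpace S] [Group G] [MulAction G S] [IsIsometricSMul G S] {D E : ℝ}

theorem dist_zpow_smul_natAbs (g : G) (k : ℤ) (x : S) :
    dist ((g ^ k) • x) x = dist ((g ^ k.natAbs) • x) x := by
  rcases Int.natAbs_eq k with h | h
  · rw [h, zpow_natCast, Int.natAbs_natCast]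
  · rw [h, dist_zpow_smul_self_neg, zpow_natCast, Int.natAbs_neg, Int.natAbs_natCast]

theorem dist_pow_smul_pow_smul (g : G) (i j : ℕ) (x : S) :
    dist ((g ^ i) • x) ((g ^ (i + j)) • x) = dist ((g ^ j) • x) x := by
  rw [pow_add, mul_smul, dist_smul, dist_comm]

/-- An isometry displacing `x` by definitely less than its square does moves `x` at a definite
speed. -/
theorem add_dist_pow_le (hD : FourPoint D S) (hD0 : 0 < D) {g : G} {x : S}
    (h : dist (g • x) x + 2 * D ≤ dist ((g ^ 2) • x) x) (n : ℕ) :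
    dist ((g ^ n) • x) x + D ≤ dist ((g ^ (n + 1)) • x) x := by
  have hl : ∀ i : ℕ, dist ((g ^ i) • x) ((g ^ (i + 1)) • x) = dist (g • x) x := fun i => by
    rw [dist_pow_smul_pow_smul, pow_one]
  induction n with
  | zero =>
    have h1 := hl 1
    have h2 := dist_triangle ((g ^ 2) • x) (g • x) x
    rw [pow_one, dist_comm] at h1
    rw [pow_zero, one_smul, dist_self, zero_add, zero_add, pow_one]
    norm_num at h1
    linarith
  | succ n ih =>
    have h1 := hl n
    have h2 := hl (n + 1)
    have h3 := dist_pow_smul_pow_smul g n 2 x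
    rcases hD ((g ^ n) • x) ((g ^ (n + 1)) • x) ((g ^ (n + 1 + 1)) • x) x with h' | h' <;>
      rw [h3] at h' <;> linarith

theorem mul_le_dist_pow (hD : FourPoint D S) (hD0 : 0 < D) {g : G} {x : S}
    (h : dist (g • x) x + 2 * D ≤ dist ((g ^ 2) • x) x) (n : ℕ) :
    n * D ≤ dist ((g ^ n) • x) x := by
  induction n with
  | zero => simp
  | succ n ih =>
    have := add_dist_pow_le hD hD0 h n
    push_cast
    linarith

theorem isLoxodromicElt_of_add_le (hD : FourPoint D S) (hD1 : 1 ≤ D) {g : G} {x : S}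
    (h : dist (g • x) x + 2 * D ≤ dist ((g ^ 2) • x) x) : IsLoxodromicElt S g := by
  refine ⟨x, 1, 0, le_rfl, le_rfl, fun n m => ?_⟩
  rw [dist_zpow_smul_zpow_smul, dist_zpow_smul_natAbs, div_one, sub_zero]
  have h1 := mul_le_dist_pow hD (by linarith) h (n - m).natAbs
  have h2 : (((n - m).natAbs : ℕ) : ℝ) = |(n : ℝ) - m| := by
    rw [Nat.cast_natAbs]; push_cast; rfl
  rw [h2] at h1
  nlinarith [abs_nonneg ((n : ℝ) - m)]

/-- An element that is not loxodromic moves some point by a small amount. -/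
theorem exists_dist_smul_le_of_not_isLoxodromicElt [Nonempty S] (hD : FourPoint D S)
    (hS : HasSegments S) (hD1 : 1 ≤ D) {g : G} (hg : ¬ IsLoxodromicElt S g) :
    ∃ y : S, dist y (g • y) ≤ 4 * D := by
  obtain ⟨x⟩ := ‹Nonempty S›
  have h : dist ((g ^ 2) • x) x < dist (g • x) x + 2 * D := by
    by_contra! h
    exact hg (isLoxodromicElt_of_add_le hD hD1 h)
  have hn := dist_nonneg (x := x) (y := g • x)
  obtain ⟨y, h1, h2⟩ := hS x (g • x) (dist x (g • x) / 2) (by linarith) (by linarith)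
  refine ⟨y, ?_⟩
  have h3 := dist_smul g x y
  have h4 := dist_smul g y (g • x)
  rw [smul_smul, ← pow_two] at h4
  have h5 := dist_smul g x (g • x)
  rw [smul_smul, ← pow_two] at h5
  have c1 := dist_comm x (g • x)
  have c2 := dist_comm x ((g ^ 2) • x)
  have c3 := dist_comm x (g • y)
  have c4 := dist_comm x y
  have c5 := dist_comm (g • x) (g • y)
  have c6 := dist_comm y (g • y)
  have c7 := dist_comm (g • y) ((g ^ 2) • x)
  have c8 := dist_comm (g • x) y
  rcases hD (g • y) (g • x) x ((g ^ 2) • x) with h6 | h6 <;>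
    rcases hD y x (g • y) (g • x) with h7 | h7 <;> linarith

theorem IsLoxodromicElt.exists_pow_add_le {b : G} (hb : IsLoxodromicElt S b) (x : S) (C : ℝ) :
    ∃ N : ℕ, 0 < N ∧ dist ((b ^ N) • x) x + C ≤ dist ((b ^ (2 * N)) • x) x := by
  by_contra! hcon
  obtain ⟨s, κ, ε, hκ, hε, h⟩ := hb
  have hκ0 : 0 < κ := by linarith
  have hup : ∀ k : ℕ, dist ((b ^ (2 ^ k)) • x) x ≤ dist (b • x) x + k * C := by
    intro k
    induction k with
    | zero => simp
    | succ k ih =>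
      have := hcon (2 ^ k) (by positivity)
      rw [pow_succ, mul_comm]
      push_cast
      linarith
  have hlow : ∀ n : ℕ, (n : ℝ) / κ - ε - 2 * dist x s ≤ dist ((b ^ n) • x) x := by
    intro n
    have h1 := h n 0
    simp only [zpow_natCast, zpow_zero, one_smul, Int.cast_natCast, Int.cast_zero, sub_zero,
      Nat.abs_cast] at h1
    have h2 := dist_triangle ((b ^ n) • s) ((b ^ n) • x) s
    have h3 := dist_triangle ((b ^ n) • x) x s
    rw [dist_smul, dist_comm s x] at h2
    linarith
  have hlim : Tendsto (fun k : ℕ => ((k : ℝ) ^ 1 / 2 ^ k)) atTop (𝓝 0) :=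
    tendsto_pow_const_div_const_pow_of_one_lt 1 (by norm_num)
  have hlim0 : Tendsto (fun k : ℕ => (((k : ℝ) ^ 0) / 2 ^ k)) atTop (𝓝 0) :=
    tendsto_pow_const_div_const_pow_of_one_lt 0 (by norm_num)
  have hl2 := (hlim.mul_const C).add (hlim0.mul_const (ε + 2 * dist x s + dist (b • x) x))
  simp only [zero_mul, add_zero, pow_one, pow_zero] at hl2
  obtain ⟨k, hk⟩ := (hl2.eventually_lt_const (show 0 < 1 / κ by positivity)).exists
  have h1 := hup k
  have h2 := hlow (2 ^ k)
  push_cast at h2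
  have hp : (0 : ℝ) < 2 ^ k := by positivity
  have h3 := mul_lt_mul_of_pos_right hk hp
  have h4 : (k / 2 ^ k * C + 1 / 2 ^ k * (ε + 2 * dist x s + dist (b • x) x)) * (2 : ℝ) ^ k =
      k * C + (ε + 2 * dist x s + dist (b • x) x) := by
    field_simp
  have h5 : 1 / κ * (2 : ℝ) ^ k = 2 ^ k / κ := by ring
  rw [h4, h5] at h3
  linarith

theorem roughBtw_of_add_le (hD : FourPoint D S) (hD0 : 0 < D) {g : G} {x : S}
    (h : dist (g • x) x + 2 * D ≤ dist ((g ^ 2) • x) x) (i j : ℕ) :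
    RoughBtw (dist (g • x) x) ((g ^ (-(i : ℤ))) • x) x ((g ^ (j : ℤ)) • x) := by
  unfold RoughBtw
  rcases j with _ | j
  · simp
  have h1 := add_dist_pow_le hD hD0 h i
  have h2 := add_dist_pow_le hD hD0 h j
  have e1 : dist ((g ^ (-(i : ℤ))) • x) x = dist ((g ^ i) • x) x := by
    rw [dist_zpow_smul_self_neg, zpow_natCast]
  have e2 : dist ((g ^ (-(i : ℤ))) • x) (g • x) = dist ((g ^ (i + 1)) • x) x := by
    have := dist_zpow_smul_zpow_smul g (-(i : ℤ)) 1 x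
    rw [zpow_one] at this
    rw [this, dist_zpow_smul_natAbs]
    congr 3; omega
  have e3 : dist ((g ^ (j + 1)) • x) (g • x) = dist ((g ^ j) • x) x := by
    rw [pow_succ', mul_smul, dist_smul]
  have e4 := dist_comm x ((g ^ (j + 1)) • x)
  rw [zpow_natCast]
  rcases hD ((g ^ (-(i : ℤ))) • x) ((g ^ (j + 1)) • x) (g • x) x with h' | h' <;> linarith

theorem IsLoxodromicElt.exists_inAxis (hD : FourPoint D S) (hD0 : 0 < D) {b : G}
    (hb : IsLoxodromicElt S b) (x : S) : ∃ E, 0 ≤ E ∧ InAxis E b x := by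
  obtain ⟨N, hN, hNx⟩ := hb.exists_pow_add_le x (2 * D)
  rw [mul_comm 2 N, pow_mul] at hNx
  have hc := roughBtw_of_add_le hD hD0 hNx
  set l := dist ((b ^ N) • x) x
  set M := ∑ r ∈ Finset.range N, dist ((b ^ r) • x) x
  have hM : ∀ r < N, dist ((b ^ r) • x) x ≤ M := fun r hr =>
    Finset.single_le_sum (f := fun r => dist ((b ^ r) • x) x) (fun _ _ => dist_nonneg)
      (Finset.mem_range.2 hr)
  have hM0 : 0 ≤ M := Finset.sum_nonneg fun _ _ => dist_nonneg
  have hl0 : 0 ≤ l := dist_nonneg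
  refine ⟨(l + 4 * M) + 2 * D, by linarith, hb.inAxis_of_roughBtw hD hD0.le fun i j => ?_⟩
  have hij := hc (i / N) (j / N)
  rw [← zpow_natCast b N, ← zpow_mul, ← zpow_mul] at hij
  have hi := hM _ (Nat.mod_lt i hN)
  have hj := hM _ (Nat.mod_lt j hN)
  have e1 : dist ((b ^ (-(i : ℤ))) • x) ((b ^ ((N : ℤ) * (-((i / N : ℕ) : ℤ)))) • x) =
      dist ((b ^ (i % N)) • x) x := by
    have h1 := Nat.div_add_mod i N
    rw [dist_zpow_smul_zpow_smul, dist_zpow_smul_natAbs]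
    congr 3
    zify at h1
    rw [mul_neg]
    have : -(i : ℤ) - -(N * ((i / N : ℕ) : ℤ)) = -((i % N : ℕ) : ℤ) := by
      push_cast; linarith
    rw [this]; simp only [Int.natAbs_neg, Int.natAbs_natCast]
  have e2 : dist ((b ^ (j : ℤ)) • x) ((b ^ ((N : ℤ) * ((j / N : ℕ) : ℤ))) • x) =
      dist ((b ^ (j % N)) • x) x := by
    have h1 := Nat.div_add_mod j N
    rw [dist_zpow_smul_zpow_smul, dist_zpow_smul_natAbs]
    congr 3
    zify at h1
    have : (j : ℤ) - (N * ((j / N : ℕ) : ℤ)) = ((j % N : ℕ) : ℤ) := by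
      push_cast; linarith
    rw [this]; simp only [Int.natAbs_natCast]
  rw [← e1] at hi
  rw [← e2] at hj
  unfold RoughBtw at *
  set P := (b ^ (-(i : ℤ))) • x
  set Q := (b ^ (j : ℤ)) • x
  set P' := (b ^ ((N : ℤ) * (-((i / N : ℕ) : ℤ)))) • x
  set Q' := (b ^ ((N : ℤ) * ((j / N : ℕ) : ℤ))) • x
  linarith [dist_triangle P P' x, dist_triangle x Q' Q, dist_comm Q Q', dist_comm P P',
    dist_triangle P' P Q', dist_triangle P Q Q']

/-- Axes with a large error are close to axes with a fixed small error. -/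
theorem InAxis.exists_near (hD : FourPoint D S) (hS : HasSegments S) (hD0 : 0 ≤ D) (hE : 0 ≤ E)
    {b : G} (hb : IsLoxodromicElt S b) {w : S} (hw : InAxis E b w) :
    ∃ w', InAxis (4 * D) b w' ∧ dist w w' ≤ 2 * E + D := by
  have e1 := hb.eventually_far w w (4 * E + 5 * D + 1)
  have e2 := e1.prod_mk e1
  rw [prod_atTop_atTop_eq] at e2
  obtain ⟨q, hq, hf⟩ := ((hw w w).and e2).exists
  have f1 := hf.1.2
  have f2 := hf.2.1
  have hP := hw.zpow_smul (-(q.1 : ℤ))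
  have hQ := hw.zpow_smul (q.2 : ℤ)
  set P := (b ^ (-(q.1 : ℤ))) • w
  set Q := (b ^ (q.2 : ℤ)) • w
  obtain ⟨w', h1, h2⟩ := hS P Q (min (dist P w) (dist P Q)) (le_min dist_nonneg dist_nonneg)
    (min_le_right _ _)
  have hbt : RoughBtw 0 P w' Q := by unfold RoughBtw; linarith
  have hPw : |dist P w - dist P w'| ≤ E := by
    unfold RoughBtw at hq
    have := dist_nonneg (x := w) (y := Q)
    rw [h1]
    rcases min_choice (dist P w) (dist P Q) with h | h <;> rw [h] <;> rw [abs_le] <;>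
      constructor <;> linarith [min_le_left (dist P w) (dist P Q)]
  have hww := hq.dist_le hD (hbt.mono hE)
  have hww' : dist w w' ≤ 2 * E + D := by linarith
  refine ⟨w', fun z z' => ?_, hww'⟩
  filter_upwards [hP z z', hQ z z'] with r hr1 hr2
  refine hbt.between_of_far hD hD0 hE hr1 hr2 ?_ ?_
  · linarith [dist_triangle P w' w, dist_comm w w']
  · linarith [dist_triangle Q w' w, dist_comm w w', dist_comm w' Q]

theorem IsLoxodromicElt.exists_inAxis_four (hD : FourPoint D S) (hS : HasSegments S)
    (hD0 : 0 < D) {b : G} (hb : IsLoxodromicElt S b) : ∃ u : S, InAxis (4 * D) b u := by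
  obtain ⟨s, -⟩ := id hb
  obtain ⟨E, hE, hs⟩ := hb.exists_inAxis hD hD0 s
  obtain ⟨u, hu, -⟩ := hs.exists_near hD hS hD0.le hE hb
  exact ⟨u, hu⟩

end Existence

/-- A bounded real sequence converges along every ultrafilter. -/
theorem Ultrafilter.exists_tendsto_of_abs_le {ι : Type*} (ω : Ultrafilter ι) {f : ι → ℝ} {M : ℝ}
    (h : ∀ i, |f i| ≤ M) : ∃ l, Tendsto f ω (𝓝 l) := by
  have hK : IsCompact (Set.Icc (-M) M) := isCompact_Icc
  obtain ⟨l, -, hl⟩ := hK.ultrafilter_le_nhds (ω.map f)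
    (by rw [le_principal_iff]; exact Filter.mem_map.2 (univ_mem' fun i => abs_le.1 (h i)))
  exact ⟨l, hl⟩

/-- A quasimorphism on the integers is at bounded distance from a homomorphism. -/
theorem exists_abs_sub_mul_le {T : ℤ → ℝ} {C : ℝ} (hT0 : T 0 = 0)
    (hT : ∀ k l, |T (k + l) - T k - T l| ≤ C) : ∃ τ : ℝ, ∀ k : ℤ, |T k - k * τ| ≤ 2 * C := by
  have hC : 0 ≤ C := (abs_nonneg _).trans (hT 0 0)
  have hmul : ∀ (k : ℤ) (n : ℕ), |T (n * k) - n * T k| ≤ n * C := by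
    intro k n
    induction n with
    | zero => simp [hT0]
    | succ n ih =>
      have h1 := hT (n * k) k
      have h2 : ((n + 1 : ℕ) : ℤ) * k = n * k + k := by push_cast; ring
      rw [h2]
      push_cast
      rw [abs_le] at *
      constructor <;> linarith [h1.1, h1.2, ih.1, ih.2]
  have hdiv : ∀ n : ℕ, |T n / n| ≤ |T 1| + C := by
    intro n
    rcases Nat.eq_zero_or_pos n with rfl | hn
    · simp only [Nat.cast_zero, div_zero, abs_zero]; positivity
    · have hn' : (0 : ℝ) < n := by exact_mod_cast hn
      have h1 := hmul 1 n
      rw [mul_one] at h1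
      rw [abs_div, Nat.abs_cast, div_le_iff₀ hn']
      have h2 := abs_sub_abs_le_abs_sub (T n) (n * T 1)
      rw [abs_mul, Nat.abs_cast] at h2
      linarith
  obtain ⟨τ, hτ⟩ := (hyperfilter ℕ).exists_tendsto_of_abs_le hdiv
  have hnat : ∀ k : ℕ, |T k - k * τ| ≤ C := by
    intro k
    have hle : ∀ n : ℕ, 0 < n → |T k - k * (T n / n)| ≤ C + k * C * (1 / n) := by
      intro n hn
      have hn' : (0 : ℝ) < n := by exact_mod_cast hn
      have h1 := hmul k n
      have h2 := hmul n k
      rw [mul_comm (k : ℤ)] at h2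
      have h3 : |n * T k - k * T n| ≤ n * C + k * C := by
        rw [abs_le] at *
        constructor <;> linarith [h1.1, h1.2, h2.1, h2.2]
      have h4 : T k - k * (T n / n) = (n * T k - k * T n) / n := by field_simp
      rw [h4, abs_div, Nat.abs_cast, div_le_iff₀ hn']
      refine h3.trans (le_of_eq ?_)
      field_simp
    have hlim1 : Tendsto (fun n : ℕ => |T k - k * (T n / n)|) (hyperfilter ℕ)
        (𝓝 |T k - k * τ|) := ((tendsto_const_nhds.sub (hτ.const_mul _))).abs
    have hlim2 : Tendsto (fun n : ℕ => C + k * C * (1 / (n : ℝ))) (hyperfilter ℕ)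
        (𝓝 (C + k * C * 0)) := by
      refine Tendsto.mono_left ?_ Nat.hyperfilter_le_atTop
      exact tendsto_const_nhds.add (tendsto_one_div_atTop_nhds_zero_nat.const_mul _)
    rw [mul_zero, add_zero] at hlim2
    exact le_of_tendsto_of_tendsto hlim1 hlim2
      (((eventually_gt_atTop 0).filter_mono Nat.hyperfilter_le_atTop).mono hle)
  refine ⟨τ, fun k => ?_⟩
  obtain ⟨n, rfl | rfl⟩ := k.eq_nat_or_neg
  · rw [Int.cast_natCast]
    linarith [hnat n]
  · have h1 := hnat n
    have h2 := hT n (-(n : ℤ))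
    rw [add_neg_cancel, hT0] at h2
    rw [Int.cast_neg, Int.cast_natCast]
    rw [abs_le] at *
    constructor <;> linarith [h1.1, h1.2, h2.1, h2.2]

/-- `β` is a coordinate along the axes of `b`, on which `b` acts coarsely as the translation
by `τ`. -/
structure AxisCoord {G S : Type*} [MetricSpace S] [Group G] [MulAction G S] (D : ℝ) (b : G)
    (β : S → ℝ) (τ : ℝ) : Prop where
  pos : 0 < τ
  lip : ∀ u v, β u - β v ≤ dist u v
  dist_le : ∀ {E : ℝ} {u v : S}, InAxis E b u → InAxis E b v →
    dist u v ≤ |β u - β v| + E + D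
  zpow_smul : ∀ {E : ℝ} {u : S}, 4 * D ≤ E → InAxis E b u → ∀ k : ℤ,
    |β ((b ^ k) • u) - β u - k * τ| ≤ 6 * E

section Coordinate

variable {G S : Type*} [MetricSpace S] [Group G] [MulAction G S] [IsIsometricSMul G S] {D E : ℝ}

/-- The Busemann function of the negative end of the axis of `b` is a coordinate along the axis. -/
theorem exists_busemann (hD : FourPoint D S) (b : G) (z : S) :
    ∃ β : S → ℝ, (∀ u v, β u - β v ≤ dist u v) ∧
      (∀ (E : ℝ) (u v : S), InAxis E b u → InAxis E b v → dist u v ≤ |β u - β v| + E + D) ∧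
      ∀ (E : ℝ) (u v : S), InAxis E b u → InAxis E b v → ∀ k : ℤ,
        |(β ((b ^ k) • u) - β u) - (β ((b ^ k) • v) - β v)| ≤ 2 * E := by
  have hbdd : ∀ (w : S) (i : ℕ),
      |dist ((b ^ (-(i : ℤ))) • z) w - dist ((b ^ (-(i : ℤ))) • z) z| ≤ dist w z := by
    intro w i
    rw [dist_comm _ w, dist_comm _ z]
    exact abs_dist_sub_le _ _ _
  choose β hβ using fun w => (hyperfilter ℕ).exists_tendsto_of_abs_le (hbdd w)
  have hsub : ∀ u v, Tendsto (fun i : ℕ => dist ((b ^ (-(i : ℤ))) • z) u -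
      dist ((b ^ (-(i : ℤ))) • z) v) (hyperfilter ℕ) (𝓝 (β u - β v)) := fun u v => by
    simpa using (hβ u).sub (hβ v)
  have hdiag : Tendsto (fun i : ℕ => (i, i)) (hyperfilter ℕ) atTop := by
    rw [← prod_atTop_atTop_eq]
    exact (tendsto_id.prodMk tendsto_id).mono_left Nat.hyperfilter_le_atTop
  refine ⟨β, fun u v => ?_, fun E u v hu hv => ?_, fun E u v hu hv k => ?_⟩
  · refine le_of_tendsto (hsub u v) (Eventually.of_forall fun i => ?_)
    linarith [dist_triangle ((b ^ (-(i : ℤ))) • z) v u, dist_comm u v]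
  · have h1 : Tendsto (fun i : ℕ => |dist ((b ^ (-(i : ℤ))) • z) u -
        dist ((b ^ (-(i : ℤ))) • z) v| + E + D) (hyperfilter ℕ) (𝓝 (|β u - β v| + E + D)) :=
      (((hsub u v).abs).add_const E).add_const D
    refine ge_of_tendsto h1 ?_
    filter_upwards [hdiag.eventually (hu z z), hdiag.eventually (hv z z)] with i hi1 hi2
    exact hi1.dist_le hD hi2
  · have h1 := ((hsub ((b ^ k) • u) u).sub (hsub ((b ^ k) • v) v)).abs
    refine le_of_tendsto h1 ?_
    filter_upwards [hdiag.eventually (hu z z), hdiag.eventually (hv z z),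
      hdiag.eventually (hu ((b ^ (-k)) • z) z), hdiag.eventually (hv ((b ^ (-k)) • z) z)]
      with i h1 h2 h3 h4
    have key : ∀ w : S, dist ((b ^ (-(i : ℤ))) • z) ((b ^ k) • w) =
        dist ((b ^ (-(i : ℤ))) • (b ^ (-k)) • z) w := by
      intro w
      rw [← dist_smul (b ^ k) ((b ^ (-(i : ℤ))) • (b ^ (-k)) • z) w, smul_smul, smul_smul,
        ← zpow_add, ← zpow_add]
      congr 3; ring
    rw [key u, key v]
    unfold RoughBtw at *
    have t1 := dist_triangle ((b ^ (-(i : ℤ))) • z) u ((b ^ (i : ℤ)) • z)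
    have t2 := dist_triangle ((b ^ (-(i : ℤ))) • z) v ((b ^ (i : ℤ)) • z)
    have t3 := dist_triangle ((b ^ (-(i : ℤ))) • (b ^ (-k)) • z) u ((b ^ (i : ℤ)) • z)
    have t4 := dist_triangle ((b ^ (-(i : ℤ))) • (b ^ (-k)) • z) v ((b ^ (i : ℤ)) • z)
    rw [abs_le]
    constructor <;> linarith

theorem IsLoxodromicElt.exists_axisCoord (hD : FourPoint D S) (hS : HasSegments S)
    (hD0 : 0 < D) {b : G} (hb : IsLoxodromicElt S b) : ∃ β τ, AxisCoord (S := S) D b β τ := by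
  obtain ⟨o, ho⟩ := hb.exists_inAxis_four hD hS hD0
  obtain ⟨β, hlip, hdist, htr⟩ := exists_busemann hD b o
  obtain ⟨τ, hτ⟩ := exists_abs_sub_mul_le (T := fun k => β ((b ^ k) • o) - β o)
    (C := 2 * (4 * D)) (by simp) (fun k l => by
      have h := htr _ _ _ (ho.zpow_smul l) ho k
      rw [smul_smul, ← zpow_add] at h
      rw [abs_le] at *
      constructor <;> linarith [h.1, h.2])
  have hz : ∀ {E : ℝ} {u : S}, 4 * D ≤ E → InAxis E b u → ∀ k : ℤ,
      |β ((b ^ k) • u) - β u - k * τ| ≤ 6 * E := by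
    intro E u hE hu k
    have h1 := htr E u o hu (ho.mono hE) k
    have h2 := hτ k
    rw [abs_le] at *
    constructor <;> linarith [h1.1, h1.2, h2.1, h2.2]
  have hτ0 : τ ≠ 0 := by
    rintro rfl
    obtain ⟨i, hi⟩ := (hb.eventually_far o o (30 * D)).exists
    have h1 := hdist _ _ _ (ho.zpow_smul i) ho
    have h2 := hz le_rfl ho i
    rw [mul_zero, sub_zero] at h2
    linarith [hi.1]
  rcases lt_or_gt_of_ne hτ0 with h | h
  · refine ⟨fun w => -β w, -τ, by linarith, fun u v => ?_, fun {E u v} hu hv => ?_,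
      fun {E u} hE hu k => ?_⟩
    · linarith [hlip v u, dist_comm u v]
    · rw [neg_sub_neg, abs_sub_comm]; exact hdist E u v hu hv
    · have := hz hE hu k
      rw [← abs_neg] at this
      convert this using 2; ring
  · exact ⟨β, τ, h, hlip, fun hu hv => hdist _ _ _ hu hv, hz⟩

end Coordinate
/-- The acylindricity condition for given constants. -/
def AcylindricalAt (G S : Type*) [Group G] [MulAction G S] [MetricSpace S] (ε R : ℝ) (N : ℕ) :
    Prop :=
  ∀ p q : S, R ≤ dist p q →
    {g : G | dist p (g • p) ≤ ε ∧ dist q (g • q) ≤ ε}.Finite ∧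
    {g : G | dist p (g • p) ≤ ε ∧ dist q (g • q) ≤ ε}.ncard ≤ N

theorem AcylindricalAt.exists_eq {G S : Type*} [MetricSpace S] [Group G] [MulAction G S] {ε R : ℝ}
    {N : ℕ} (hA : AcylindricalAt G S ε R N) {p q : S} (hpq : R ≤ dist p q) (f : ℕ → G)
    (hf : ∀ i ≤ N, dist p (f i • p) ≤ ε ∧ dist q (f i • q) ≤ ε) :
    ∃ i j, i < j ∧ j ≤ N ∧ f i = f j := by
  obtain ⟨hfin, hcard⟩ := hA p q hpq
  have hlt : hfin.toFinset.card < (Finset.range (N + 1)).card := by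
    rw [Finset.card_range, ← Set.ncard_eq_toFinset_card _ hfin]
    omega
  obtain ⟨i, hi, j, hj, hij, h⟩ := Finset.exists_ne_map_eq_of_card_lt_of_maps_to hlt
    (f := f) (fun i hi => by
      rw [Finset.mem_coe, Set.Finite.mem_toFinset]
      exact hf i (Nat.lt_succ_iff.1 (Finset.mem_range.1 hi)))
  rw [Finset.mem_range] at hi hj
  rcases lt_or_gt_of_ne hij with h' | h'
  · exact ⟨i, j, h', by omega, h⟩
  · exact ⟨j, i, h', by omega, h.symm⟩

section Algebra

variable {G : Type*} [Group G]

theorem mem_elemSubset_iff {g f : G} : f ∈ ElemSubset g ↔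
    ∃ n : ℤ, n ≠ 0 ∧ (SemiconjBy f (g ^ n) (g ^ n) ∨ SemiconjBy f (g ^ n)⁻¹ (g ^ n)) := by
  have key : ∀ x y : G, f⁻¹ * x * f = y ↔ SemiconjBy f y x := fun x y => by
    rw [mul_assoc, inv_mul_eq_iff_eq_mul]
    exact eq_comm
  constructor
  · rintro ⟨n, hn, h⟩
    rw [key, key] at h
    exact ⟨n, by exact_mod_cast hn.ne', by simpa using h⟩
  · rintro ⟨n, hn, h⟩
    refine ⟨n.natAbs, Int.natAbs_pos.2 hn, ?_⟩
    rw [key, key]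
    rcases Int.natAbs_eq n with h' | h'
    · rwa [h', zpow_natCast] at h
    · rw [h', zpow_neg, zpow_natCast, SemiconjBy.inv_right_iff] at h
      rw [inv_inv] at h
      exact h.imp id fun h => by simpa using h.inv_right

theorem elemSubset_subset_of_zpow_eq {a b : G} {p q : ℤ} (hq : q ≠ 0)
    (h : a ^ p = b ^ q) : ElemSubset a ⊆ ElemSubset b := by
  intro f hf
  rw [mem_elemSubset_iff] at *
  obtain ⟨n, hn, hn'⟩ := hf
  have e : (a ^ n) ^ p = b ^ (q * n) := by rw [zpow_mul, ← h, ← zpow_mul, ← zpow_mul, mul_comm]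
  refine ⟨q * n, mul_ne_zero hq hn, ?_⟩
  rw [← e, ← inv_zpow]
  exact hn'.imp (fun h => h.zpow_right p) fun h => h.zpow_right p

theorem elemSubset_eq_of_zpow_eq {a b : G} {p q : ℤ} (hp : p ≠ 0) (hq : q ≠ 0)
    (h : a ^ p = b ^ q) : ElemSubset a = ElemSubset b :=
  (elemSubset_subset_of_zpow_eq hq h).antisymm (elemSubset_subset_of_zpow_eq hp h.symm)

theorem elemSubset_inv (a : G) : ElemSubset a⁻¹ = ElemSubset a :=
  elemSubset_eq_of_zpow_eq (p := -1) (q := 1) (by simp) (by simp) (by simp)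

theorem commute_sq_of_conj {g x : G} (h : g * x * g⁻¹ = x ∨ g * x * g⁻¹ = x⁻¹) :
    Commute (g ^ 2) x := by
  rw [mul_inv_eq_iff_eq_mul, mul_inv_eq_iff_eq_mul] at h
  rw [pow_two]
  rcases h with h | h
  · exact SemiconjBy.mul_left h h
  · have h' : SemiconjBy g x⁻¹ x := by simpa using SemiconjBy.inv_right (y := x⁻¹) h
    exact SemiconjBy.mul_left h' h

end Algebra

section Axes

variable {G S : Type*} [MetricSpace S] [Group G] [MulAction G S]
  {D E ε R τ : ℝ} {N : ℕ} {b : G} {β : S → ℝ}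

theorem AxisCoord.abs_sub_le (hβ : AxisCoord D b β τ) (u v : S) : |β u - β v| ≤ dist u v := by
  rw [abs_le]
  constructor <;> linarith [hβ.lip u v, hβ.lip v u, dist_comm u v]

theorem AxisCoord.le_dist_pow (hβ : AxisCoord D b β τ) {u : S} (hu : InAxis (4 * D) b u) (k : ℕ) :
    k * τ - 24 * D ≤ dist u ((b ^ k) • u) := by
  have h1 := hβ.zpow_smul le_rfl hu k
  have h2 := hβ.lip ((b ^ k) • u) u
  rw [zpow_natCast, Int.cast_natCast] at *
  rw [dist_comm]
  linarith [(abs_le.1 h1).1]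

variable [IsIsometricSMul G S]

theorem AxisCoord.dist_pow_le (hβ : AxisCoord D b β τ) {u : S} (hu : InAxis (4 * D) b u) (k : ℕ) :
    dist u ((b ^ k) • u) ≤ k * τ + 29 * D := by
  have h1 := hβ.zpow_smul le_rfl hu k
  have h2 := hβ.dist_le (hu.zpow_smul k) hu
  have h3 := mul_nonneg (Nat.cast_nonneg (α := ℝ) k) hβ.pos.le
  rw [zpow_natCast, Int.cast_natCast] at *
  rw [dist_comm]
  rcases abs_cases (β ((b ^ k) • u) - β u) with h | h <;>
    linarith [(abs_le.1 h1).1, (abs_le.1 h1).2]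

/-- Acylindricity bounds the translation lengths of loxodromic elements from below. -/
theorem AxisCoord.one_lt_mul (hβ : AxisCoord D b β τ) (hD : FourPoint D S) (hS : HasSegments S)
    (hD0 : 0 < D) (hb : IsLoxodromicElt S b) (hA : AcylindricalAt G S ε R N)
    (hε : 29 * D + 1 ≤ ε) : 1 < N * τ := by
  by_contra! hN
  obtain ⟨u, hu⟩ := hb.exists_inAxis_four hD hS hD0
  obtain ⟨M, hM, -⟩ := (hb.eventually_far u u R).exists
  rw [dist_comm] at hM
  have key : ∀ v : S, InAxis (4 * D) b v → ∀ i ≤ N, dist v ((b ^ i) • v) ≤ ε := by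
    intro v hv i hi
    have h1 := hβ.dist_pow_le hv i
    have h2 : (i : ℝ) * τ ≤ N * τ := mul_le_mul_of_nonneg_right (by exact_mod_cast hi) hβ.pos.le
    linarith
  obtain ⟨i, j, hij, -, h⟩ := hA.exists_eq hM (fun i => b ^ i)
    fun i hi => ⟨key u hu i hi, key _ (hu.zpow_smul M) i hi⟩
  have h' : (fun i : ℤ => b ^ i) i = (fun i : ℤ => b ^ i) j := by simpa using h
  have := hb.zpow_injective h'
  omega

/-- An element carrying two points of the axis to the axis acts on the segment between them
coarsely as an isometry of the axis. -/
theorem AxisCoord.inAxis_smul (hβ : AxisCoord D b β τ) (hD : FourPoint D S) (hDE : 4 * D ≤ E)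
    (hE : 0 ≤ E) {g : G} {u v w : S} (hu : InAxis E b u) (hv : InAxis E b v)
    (hgu : InAxis E b (g • u)) (hgv : InAxis E b (g • v)) {σ : ℤ} (hσ : σ = 1 ∨ σ = -1)
    (huv : dist u v ≤ σ * (β (g • v) - β (g • u)) + 2 * E) (hw : InAxis E b w)
    (hw1 : β u - 6 * E ≤ β w) (hw2 : β w ≤ β v + 6 * E) :
    InAxis (58 * E) b (g • w) ∧ |σ * (β (g • w) - β (g • u)) - (β w - β u)| ≤ 16 * E := by
  have d1 : dist u w ≤ β w - β u + 14 * E := by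
    have := hβ.dist_le hu hw
    rcases abs_cases (β u - β w) with h | h <;> linarith
  have d2 : dist w v ≤ β v - β w + 14 * E := by
    have := hβ.dist_le hw hv
    rcases abs_cases (β w - β v) with h | h <;> linarith
  have l := hβ.lip v u
  rw [dist_comm] at l
  refine ⟨?_, ?_⟩
  · have hbt : RoughBtw (28 * E) u w v := by unfold RoughBtw; linarith
    exact (hgu.of_between hD hgv ((roughBtw_smul_iff g).2 hbt)).mono (by linarith)
  · have e1 := hβ.abs_sub_le (g • w) (g • u)
    have e2 := hβ.abs_sub_le (g • v) (g • w)
    rw [dist_smul] at e1 e2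
    rw [dist_comm w u] at e1
    rw [dist_comm v w] at e2
    rw [abs_le] at *
    rcases hσ with rfl | rfl <;> push_cast at * <;> constructor <;>
      linarith [e1.1, e1.2, e2.1, e2.2]

/-- An element carrying a long piece of the axis of `b` near the axis of `b` normalizes a power
of `b`. -/
theorem AxisCoord.exists_conj_pow (hβ : AxisCoord D b β τ) (hD : FourPoint D S) (hD0 : 0 ≤ D)
    (hDE : 4 * D ≤ E) (hA : AcylindricalAt G S ε R N) (hε : 445 * E ≤ ε) {g : G} {u v : S}
    (hu : InAxis E b u) (hv : InAxis E b v) (hgu : InAxis E b (g • u)) (hgv : InAxis E b (g • v))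
    (hR : 0 ≤ R) (huv : N * τ + R + 8 * E ≤ dist u v) :
    ∃ k : ℕ, 0 < k ∧ (g * b ^ k * g⁻¹ = b ^ k ∨ g * b ^ k * g⁻¹ = (b ^ k)⁻¹) := by
  wlog hle : β u ≤ β v generalizing u v
  · exact this hv hu hgv hgu (by rwa [dist_comm]) (le_of_not_ge hle)
  have hE : 0 ≤ E := by linarith
  have hNτ : 0 ≤ N * τ := mul_nonneg (Nat.cast_nonneg _) hβ.pos.le
  have d1 := hβ.dist_le hu hv
  rw [abs_sub_comm, abs_of_nonneg (by linarith)] at d1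
  obtain ⟨σ, hσ, hσuv⟩ : ∃ σ : ℤ, (σ = 1 ∨ σ = -1) ∧
      dist u v ≤ σ * (β (g • v) - β (g • u)) + 2 * E := by
    have d2 := hβ.dist_le hgu hgv
    rw [dist_smul] at d2
    rcases abs_cases (β (g • u) - β (g • v)) with h | h
    · exact ⟨-1, Or.inr rfl, by push_cast; linarith⟩
    · exact ⟨1, Or.inl rfl, by push_cast; linarith⟩
  have hcl : ∀ w, InAxis E b w → β u - 6 * E ≤ β w → β w ≤ β v + 6 * E →
      InAxis (58 * E) b (g • w) ∧ |σ * (β (g • w) - β (g • u)) - (β w - β u)| ≤ 16 * E :=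
    fun w => hβ.inAxis_smul hD hDE hE hu hv hgu hgv hσ hσuv
  have hmove : ∀ (p : S) (i : ℤ), InAxis E b p → β u - 6 * E ≤ β p → β p ≤ β v + 6 * E →
      β u - 6 * E ≤ β ((b ^ i) • p) → β ((b ^ i) • p) ≤ β v + 6 * E →
      dist p ((g⁻¹ * b ^ (-(σ * i)) * g * b ^ i) • p) ≤ ε := by
    intro p i hp h1 h2 h3 h4
    obtain ⟨a1, c1⟩ := hcl p hp h1 h2
    obtain ⟨a2, c2⟩ := hcl _ (hp.zpow_smul i) h3 h4
    have t1 := hβ.zpow_smul hDE hp i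
    have t2 := hβ.zpow_smul (by linarith) a1 (σ * i)
    have t3 := hβ.dist_le (a1.zpow_smul (σ * i)) a2
    have e : dist p ((g⁻¹ * b ^ (-(σ * i)) * g * b ^ i) • p) =
        dist ((b ^ (σ * i)) • g • p) (g • (b ^ i) • p) := by
      rw [← dist_smul (b ^ (σ * i) * g), zpow_neg]
      simp only [smul_smul]
      congr 2
      group
    rw [e]
    refine t3.trans ?_
    suffices h : |β ((b ^ (σ * i)) • g • p) - β (g • (b ^ i) • p)| ≤ 386 * E by linarith
    push_cast at t2
    rw [abs_le] at *
    rcases hσ with rfl | rfl <;> push_cast at * <;> constructor <;>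
      linarith [c1.1, c1.2, c2.1, c2.2, t1.1, t1.2, t2.1, t2.2]
  have hi : ∀ i ≤ N, (0 : ℝ) ≤ i * τ ∧ (i : ℝ) * τ ≤ N * τ := fun i hi =>
    ⟨mul_nonneg (Nat.cast_nonneg _) hβ.pos.le,
      mul_le_mul_of_nonneg_right (by exact_mod_cast hi) hβ.pos.le⟩
  have hv' := hv.zpow_smul (-(N : ℤ))
  have hβv' := hβ.zpow_smul hDE hv (-(N : ℤ))
  push_cast at hβv'
  have hfar : R ≤ dist u ((b ^ (-(N : ℤ))) • v) := by
    have h1 := hβ.dist_le hv' hv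
    have h2 := dist_triangle u ((b ^ (-(N : ℤ))) • v) v
    have h3 : |β ((b ^ (-(N : ℤ))) • v) - β v| ≤ N * τ + 6 * E := by
      rw [abs_le] at *
      constructor <;> linarith [hβv'.1, hβv'.2]
    linarith
  obtain ⟨i, j, hij, -, h⟩ := hA.exists_eq hfar
    (fun i : ℕ => g⁻¹ * b ^ (-(σ * (i : ℤ))) * g * b ^ (i : ℤ)) fun i hiN => by
      obtain ⟨i0, i1⟩ := hi i hiN
      have h1 := abs_le.1 (hβ.zpow_smul hDE hu i)
      have h2 := abs_le.1 (hβ.zpow_smul hDE hv ((i : ℤ) - N))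
      have h3 := abs_le.1 hβv'
      have e : (b ^ (i : ℤ)) • (b ^ (-(N : ℤ))) • v = (b ^ ((i : ℤ) - N)) • v := by
        rw [smul_smul, ← zpow_add, sub_eq_add_neg]
      push_cast at h1 h2
      refine ⟨hmove u i hu (by linarith) (by linarith) ?_ ?_, hmove _ i hv' ?_ ?_ ?_ ?_⟩
      · linarith [h1.1]
      · linarith [h1.2]
      · linarith [h3.1]
      · linarith [h3.2]
      · rw [e]; linarith [h2.1]
      · rw [e]; linarith [h2.2]
  refine ⟨j - i, by omega, ?_⟩
  have hb' : g * b ^ (j - i) * g⁻¹ = b ^ (σ * ((j : ℤ) - i)) := by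
    have hji : ((j - i : ℕ) : ℤ) = (j : ℤ) - i := by omega
    rw [← zpow_natCast, hji]
    simp only [mul_assoc, mul_right_inj] at h
    have h' : b ^ (σ * (j : ℤ)) * (b ^ (-(σ * (i : ℤ))) * (g * b ^ (i : ℤ))) = g * b ^ (j : ℤ) := by
      rw [h, ← mul_assoc, ← zpow_add, add_neg_cancel, zpow_zero, one_mul]
    rw [zpow_sub, ← mul_assoc, ← h', mul_sub, sub_eq_add_neg, zpow_add]
    group
  rw [hb']
  have hji : (j : ℤ) - i = ((j - i : ℕ) : ℤ) := by omega
  rcases hσ with rfl | rfl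
  · left; rw [one_mul, hji, zpow_natCast]
  · right; rw [neg_one_mul, zpow_neg, hji, zpow_natCast]

/-- Commuting loxodromic elements are commensurable. -/
theorem IsLoxodromicElt.exists_zpow_eq (hD : FourPoint D S) (hS : HasSegments S) (hD0 : 0 < D)
    (hA : AcylindricalAction G S) {a : G} (ha : IsLoxodromicElt S a) (hb : IsLoxodromicElt S b)
    (hc : Commute a b) : ∃ p q : ℤ, p ≠ 0 ∧ q ≠ 0 ∧ a ^ p = b ^ q := by
  obtain ⟨β, τ, hβ⟩ := hb.exists_axisCoord hD hS hD0
  obtain ⟨u, hu⟩ := hb.exists_inAxis_four hD hS hD0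
  obtain ⟨R, N, -, hA⟩ := hA (τ + 29 * D) (by linarith [hβ.pos])
  obtain ⟨M, hM, -⟩ := (hb.eventually_far u u R).exists
  rw [dist_comm] at hM
  set r : ℕ → ℤ := fun i => round ((β ((a ^ i) • u) - β u) / τ)
  have hr : ∀ i, |β ((a ^ i) • u) - β u - r i * τ| ≤ τ := by
    intro i
    have h1 := abs_sub_round ((β ((a ^ i) • u) - β u) / τ)
    have h2 : β ((a ^ i) • u) - β u - r i * τ = ((β ((a ^ i) • u) - β u) / τ - r i) * τ := by
      rw [sub_mul, div_mul_cancel₀ _ hβ.pos.ne']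
    rw [h2, abs_mul, abs_of_pos hβ.pos]
    nlinarith [hβ.pos]
  have hcomm : ∀ i, Commute (b ^ (-(r i)) * a ^ i) b := fun i =>
    ((Commute.refl b).zpow_left _).mul_left (hc.pow_left i)
  have hmove : ∀ i, dist u ((b ^ (-(r i)) * a ^ i) • u) ≤ τ + 29 * D := by
    intro i
    have h0 : InAxis (4 * D) b ((a ^ i) • u) := hu.smul_of_commute (hc.pow_left i)
    have h1 := hβ.zpow_smul le_rfl h0 (-(r i))
    have h2 := hβ.dist_le (h0.zpow_smul (-(r i))) hu
    have h3 := hr i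
    rw [mul_smul, dist_comm]
    push_cast at h1
    have h4 : |β ((b ^ (-(r i))) • (a ^ i) • u) - β u| ≤ τ + 24 * D := by
      rw [abs_le] at *
      constructor <;> linarith [h1.1, h1.2, h3.1, h3.2]
    linarith
  obtain ⟨i, j, hij, -, h⟩ := AcylindricalAt.exists_eq hA hM (fun i => b ^ (-(r i)) * a ^ i)
    fun i _ => ⟨hmove i, by
      rw [smul_smul, ((hcomm i).zpow_right (M : ℤ)).eq, mul_smul, dist_smul]
      exact hmove i⟩
  have hpow : a ^ ((j : ℤ) - i) = b ^ (r j - r i) := by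
    have h' : b ^ (-(r i)) * a ^ (i : ℤ) = b ^ (-(r j)) * a ^ (j : ℤ) := by simpa using h
    have h2 : b ^ (r j) * b ^ (-(r i)) * a ^ (i : ℤ) = a ^ (j : ℤ) := by
      rw [mul_assoc, h', ← mul_assoc, ← zpow_add, add_neg_cancel, zpow_zero, one_mul]
    rw [zpow_sub, ← h2, mul_inv_cancel_right, ← zpow_add, ← sub_eq_add_neg]
  refine ⟨(j : ℤ) - i, r j - r i, by omega, fun h0 => ?_, hpow⟩
  rw [h0, zpow_zero] at hpow
  have h' : (fun k : ℤ => a ^ k) ((j : ℤ) - i) = (fun k : ℤ => a ^ k) 0 := by simpa using hpow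
  have := ha.zpow_injective h'
  omega

/-- If a power of `a` normalizes a power of `b`, then the elementary subgroups agree. -/
theorem IsLoxodromicElt.elemSubset_eq (hD : FourPoint D S) (hS : HasSegments S) (hD0 : 0 < D)
    (hA : AcylindricalAction G S) {a : G} (ha : IsLoxodromicElt S a) (hb : IsLoxodromicElt S b)
    {n k : ℕ} (hn : 0 < n) (hk : 0 < k)
    (h : a ^ n * b ^ k * (a ^ n)⁻¹ = b ^ k ∨ a ^ n * b ^ k * (a ^ n)⁻¹ = (b ^ k)⁻¹) :
    ElemSubset a = ElemSubset b := by
  obtain ⟨p, q, hp, hq, hpq⟩ := ((ha.pow hn).pow two_pos).exists_zpow_eq hD hS hD0 hA (hb.pow hk)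
    (commute_sq_of_conj h)
  rw [← pow_mul, ← zpow_natCast, ← zpow_natCast, ← zpow_mul, ← zpow_mul] at hpq
  refine elemSubset_eq_of_zpow_eq (mul_ne_zero ?_ hp) (mul_ne_zero ?_ hq) hpq
  · exact_mod_cast (Nat.mul_pos hn two_pos).ne'
  · exact_mod_cast hk.ne'

/-- Coarse projection to the axis. -/
theorem IsLoxodromicElt.exists_projection (hD : FourPoint D S) (hS : HasSegments S) (hD0 : 0 < D)
    (hb : IsLoxodromicElt S b) (y : S) :
    ∃ u, InAxis (4 * D) b u ∧ ∀ v, InAxis (4 * D) b v → RoughBtw (30 * D) y u v := by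
  obtain ⟨u, hu, hyu⟩ := (Metric.infDist_lt_iff (s := {v : S | InAxis (4 * D) b v}) (x := y)
    (hb.exists_inAxis_four hD hS hD0)).1 (lt_add_of_pos_right _ hD0)
  refine ⟨u, hu, fun v hv => ?_⟩
  have t1 := dist_triangle u v y
  have t2 := dist_triangle y u v
  have t3 := dist_triangle u y v
  have c1 := dist_comm u y
  have c2 := dist_comm v y
  obtain ⟨w, hw1, hw2⟩ := hS u v ((dist u y + dist u v - dist y v) / 2) (by linarith) (by linarith)
  have hw : InAxis (4 * D + 2 * 0 + 2 * D) b w :=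
    hu.of_between hD hv (by unfold RoughBtw; linarith)
  obtain ⟨w', hw', hww'⟩ := hw.exists_near hD hS hD0.le (by linarith) hb
  have h1 := Metric.infDist_le_dist_of_mem (x := y)
    (show w' ∈ {v : S | InAxis (4 * D) b v} from hw')
  have h2 := dist_triangle y w w'
  unfold RoughBtw
  rcases hD y u w v with h | h <;> linarith

/-- The displacement of a point by a power of `b`, computed through the projection to the axis. -/
theorem dist_add_le_of_projection (hD : FourPoint D S) (hD0 : 0 ≤ D) {y u : S}
    (hu : InAxis (4 * D) b u) (hp : ∀ v, InAxis (4 * D) b v → RoughBtw (30 * D) y u v) (m : ℕ)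
    (hm : 31 * D < dist u ((b ^ m) • u)) :
    2 * dist y u + dist u ((b ^ m) • u) ≤ dist y ((b ^ m) • y) + 61 * D := by
  have h1 := hp _ (hu.zpow_smul m)
  have h2 := (roughBtw_smul_iff (b ^ m)).2 (hp _ (hu.zpow_smul (-(m : ℤ)))).symm
  rw [zpow_natCast] at h1
  rw [zpow_neg, zpow_natCast, smul_inv_smul] at h2
  have h3 := RoughBtw.chain hD hD0 h1 h2 (by linarith)
  rw [dist_smul, dist_comm u y] at h3
  linarith

end Axes

section Product

variable {G S : Type*} [MetricSpace S] [Group G] [MulAction G S] [IsIsometricSMul G S]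
  {D τ τ' : ℝ} {a b : G} {β α : S → ℝ}

/-- If `a ^ n` and `b ^ m` nearly agree at `y`, then the piece of the axis of `a` between the
projection `s` of `y` and its translate lies near the axis of `b`, provided that the projection
to the axis of `a` is at least as far as the projection `u` to the axis of `b`. -/
theorem inAxis_of_dist_pow_smul_le (hD : FourPoint D S) (hD0 : 0 < D) {y u s : S} {n m : ℕ}
    (hu : InAxis (4 * D) b u) (hub : ∀ v, InAxis (4 * D) b v → RoughBtw (30 * D) y u v)
    (hs : InAxis (4 * D) a s) (hsa : ∀ v, InAxis (4 * D) a v → RoughBtw (30 * D) y s v)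
    (hum : 31 * D < dist u ((b ^ m) • u)) (hsn : 31 * D < dist s ((a ^ n) • s))
    (hy : dist ((a ^ n) • y) ((b ^ m) • y) ≤ 4 * D) (hle : dist y u ≤ dist y s) :
    InAxis (822 * D) b s ∧ InAxis (822 * D) b ((a ^ n) • s) ∧ InAxis (822 * D) b ((a ^ n) • u) ∧
      dist u ((b ^ m) • u) ≤ 2 * (dist y s - dist y u) + dist s ((a ^ n) • s) + 65 * D := by
  have k1 := dist_add_le_of_projection hD hD0.le hu hub m hum
  have k2 := dist_add_le_of_projection hD hD0.le hs hsa n hsn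
  have hu' := hu.zpow_smul m
  rw [zpow_natCast] at hu'
  have e1 : dist ((b ^ m) • u) ((b ^ m) • y) = dist y u := by rw [dist_smul, dist_comm]
  have e2 : dist ((a ^ n) • s) ((a ^ n) • y) = dist y s := by rw [dist_smul, dist_comm]
  have e3 : dist ((a ^ n) • u) ((a ^ n) • y) = dist y u := by rw [dist_smul, dist_comm]
  have e4 : dist ((a ^ n) • u) ((a ^ n) • s) = dist u s := dist_smul _ _ _
  set u' := (b ^ m) • u
  set s' := (a ^ n) • s
  set x := (a ^ n) • u
  set z := (b ^ m) • y
  set z' := (a ^ n) • y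
  have t1 := dist_triangle y z' z
  have t2 := dist_triangle y z z'
  have t3 := dist_triangle s s' z
  have t4 := dist_triangle s' z' z
  have t5 := dist_triangle s z z'
  have t6 := dist_triangle s' z z'
  have t7 := dist_triangle y u' z
  have t8 := dist_triangle y u u'
  have t9 := dist_triangle y s z'
  have t10 := dist_triangle y s' z'
  have t11 := dist_triangle y s s'
  have t12 := dist_triangle u u' z
  have t13 := dist_triangle x z' z
  have t14 := dist_triangle y s' x
  have t15 := dist_triangle x z z'
  have t16 := dist_triangle y s z
  have t17 := dist_triangle y s' z
  have c1 := dist_comm z z'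
  have c2 := dist_comm s' x
  have bu : RoughBtw (69 * D) y u z := by unfold RoughBtw; linarith
  have bu' : RoughBtw (69 * D) y u' z := by unfold RoughBtw; linarith
  have bs : RoughBtw (69 * D) y s z := by unfold RoughBtw; linarith
  have bs' : RoughBtw (69 * D) y s' z := by unfold RoughBtw; linarith
  have d1 := bu.dist_le hD bs
  have d2 := bs.dist_le hD bu'
  have d3 := bu.dist_le hD bs'
  have d4 := bs'.dist_le hD bu'
  rw [abs_of_nonpos (by linarith)] at d1
  have hxz : RoughBtw (147 * D) y x z := by unfold RoughBtw; linarith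
  have d5 := (hxz.symm).dist_le hD (bu'.symm.mono (by linarith))
  rw [dist_comm z x, dist_comm z u'] at d5
  unfold RoughBtw at bs bs' bu bu'
  have d2' : dist s u' ≤ dist y u' - dist y s + 338 * D := by
    rcases abs_cases (dist y s - dist y u') with h | h <;> linarith
  have d3' : dist u s' ≤ dist y s' - dist y u + 192 * D := by
    rcases abs_cases (dist y u - dist y s') with h | h <;> linarith
  have d4' : dist s' u' ≤ dist y u' - dist y s' + 216 * D := by
    rcases abs_cases (dist y s' - dist y u') with h | h <;> linarith
  have d5' : dist u' x ≤ 152 * D := by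
    rw [dist_comm]
    rcases abs_cases (dist x z - dist u' z) with h | h <;> linarith
  refine ⟨(hu.of_between hD hu' (show RoughBtw (408 * D) u s u' from ?_)).mono (by linarith),
    (hu.of_between hD hu' (show RoughBtw (408 * D) u s' u' from ?_)).mono (by linarith),
    (hu'.of_dist_le d5').mono (by linarith), ?_⟩
  · unfold RoughBtw; linarith
  · unfold RoughBtw; linarith
  · linarith

theorem elemSubset_eq_of_dist_pow_smul_le_of_le {R : ℝ} {N : ℕ} (hD : FourPoint D S)
    (hS : HasSegments S) (hD1 : 1 ≤ D) (hacyl : AcylindricalAction G S) (hR : 0 < R)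
    (hA : AcylindricalAt G S (450000 * D) R N) (ha : IsLoxodromicElt S a)
    (hb : IsLoxodromicElt S b) {y u s : S} {n m : ℕ}
    (hu : InAxis (4 * D) b u) (hub : ∀ v, InAxis (4 * D) b v → RoughBtw (30 * D) y u v)
    (hs : InAxis (4 * D) a s) (hsa : ∀ v, InAxis (4 * D) a v → RoughBtw (30 * D) y s v)
    (hn : 4 * N + N * (4 * R + 40000 * D) + 2 ≤ (n : ℝ))
    (hm : 4 * N + N * (4 * R + 40000 * D) + 2 ≤ (m : ℝ))
    (hy : dist ((a ^ n) • y) ((b ^ m) • y) ≤ 4 * D) (hle : dist y u ≤ dist y s) :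
    ElemSubset a = ElemSubset b := by
  have hD0 : 0 < D := by linarith
  obtain ⟨β, τ, hβ⟩ := hb.exists_axisCoord hD hS hD0
  obtain ⟨α, τ', hα⟩ := ha.exists_axisCoord hD hS hD0
  have hN0 : (0 : ℝ) ≤ N := Nat.cast_nonneg _
  have hlarge : ∀ (k : ℕ) (t : ℝ), 0 < t → 1 < N * t →
      4 * N + N * (4 * R + 40000 * D) + 2 ≤ (k : ℝ) →
      4 * (N * t) + (4 * R + 40000 * D) ≤ k * t := by
    intro k t ht hNt hk
    have h1 := mul_le_mul_of_nonneg_right hk ht.le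
    have h2 : 0 ≤ (N * t - 1) * (4 * R + 40000 * D) :=
      mul_nonneg (by linarith) (by linarith)
    linarith
  have hτ := hβ.one_lt_mul hD hS hD0 hb hA (by linarith)
  have hτ' := hα.one_lt_mul hD hS hD0 ha hA (by linarith)
  have hmτ := hlarge m τ hβ.pos hτ hm
  have hnτ := hlarge n τ' hα.pos hτ' hn
  have hum := hβ.le_dist_pow hu m
  have hsn := hα.le_dist_pow hs n
  have hsn' := hα.dist_pow_le hs n
  obtain ⟨hsb, hsb', hub', hlen⟩ := inAxis_of_dist_pow_smul_le hD hD0 hu hub hs hsa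
    (by linarith) (by linarith) hy hle
  have hn2 : (2 : ℝ) ≤ n := by
    have := mul_nonneg hN0 (show 0 ≤ 4 * R + 40000 * D by linarith)
    linarith
  have hn2' : 2 ≤ n := by exact_mod_cast hn2
  have hmid : ∀ i ≤ n, InAxis (1000 * D) b ((a ^ i) • s) := by
    intro i hi
    have h1 := hα.dist_pow_le hs i
    have h2 := hα.dist_pow_le hs (n - i)
    have h3 : dist ((a ^ i) • s) ((a ^ n) • s) = dist s ((a ^ (n - i)) • s) := by
      rw [← dist_smul (a ^ i) s, smul_smul, ← pow_add, Nat.add_sub_cancel' hi]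
    rw [Nat.cast_sub hi] at h2
    exact (hsb.of_between hD hsb' (show RoughBtw (82 * D) s ((a ^ i) • s) ((a ^ n) • s) by
      unfold RoughBtw; linarith)).mono (by linarith)
  by_cases hc : N * τ + R + 8 * (1000 * D) ≤ dist u s
  · obtain ⟨k, hk, h⟩ := hβ.exists_conj_pow hD hD0.le (E := 1000 * D) (by linarith) hA
      (by linarith) (hu.mono (by linarith)) (hsb.mono (by linarith)) (hub'.mono (by linarith))
      (hsb'.mono (by linarith)) hR.le hc
    exact ha.elemSubset_eq hD hS hD0 hacyl hb (by omega) hk h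
  · have hus := dist_triangle y u s
    have hn1 := hα.le_dist_pow hs (n - 1)
    rw [Nat.cast_sub (by omega : 1 ≤ n), Nat.cast_one] at hn1
    have h1 := mul_le_mul_of_nonneg_right hn2 hα.pos.le
    have hm0 := hmid 0 (by omega)
    have hm1 := hmid 1 (by omega)
    rw [pow_zero, one_smul] at hm0
    obtain ⟨k, hk, h⟩ := hβ.exists_conj_pow hD hD0.le (E := 1000 * D) (by linarith) hA
      (by linarith) (g := a ^ 1) hm0 (hmid (n - 1) (by omega)) hm1
      (by rw [smul_smul, ← pow_add, Nat.add_sub_cancel' (by omega : 1 ≤ n)]; exact hmid n le_rfl)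
      hR.le (by linarith)
    exact ha.elemSubset_eq hD hS hD0 hacyl hb one_pos hk h

/-- If long powers of `a` and `b` nearly agree at a point, then the elementary subgroups agree. -/
theorem elemSubset_eq_of_dist_pow_smul_le {R : ℝ} {N : ℕ} (hD : FourPoint D S)
    (hS : HasSegments S) (hD1 : 1 ≤ D) (hacyl : AcylindricalAction G S) (hR : 0 < R)
    (hA : AcylindricalAt G S (450000 * D) R N) (ha : IsLoxodromicElt S a)
    (hb : IsLoxodromicElt S b) {y : S} {n m : ℕ}
    (hn : 4 * N + N * (4 * R + 40000 * D) + 2 ≤ (n : ℝ))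
    (hm : 4 * N + N * (4 * R + 40000 * D) + 2 ≤ (m : ℝ))
    (hy : dist ((a ^ n) • y) ((b ^ m) • y) ≤ 4 * D) : ElemSubset a = ElemSubset b := by
  obtain ⟨u, hu, hub⟩ := hb.exists_projection hD hS (by linarith) y
  obtain ⟨s, hs, hsa⟩ := ha.exists_projection hD hS (by linarith) y
  rcases le_total (dist y u) (dist y s) with h | h
  · exact elemSubset_eq_of_dist_pow_smul_le_of_le hD hS hD1 hacyl hR hA ha hb hu hub hs hsa hn hm
      hy h
  · rw [dist_comm] at hy
    exact (elemSubset_eq_of_dist_pow_smul_le_of_le hD hS hD1 hacyl hR hA hb ha hs hsa hu hub hm hn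
      hy h).symm

end Product

/-- If `G` acts coboundedly and acylindrically on a hyperbolic geodesic
space `S`, there is `C₀ ∈ ℕ` such that for loxodromic `a, b` with `E_G(a) ≠ E_G(b)` and all
`n, m ≥ C₀`, the product `aⁿ bᵐ` is loxodromic. -/
theorem lox_lox_product {S G : Type*} [MetricSpace S] [Group G] [MulAction G S]
    (δ : ℝ) (hδ : 0 ≤ δ) (hhyp : DeltaHyperbolic δ S) (hiso : IsometricAction G S)
    (hcob : CoboundedAction G S) (hacyl : AcylindricalAction G S) :
    ∃ C₀ : ℕ, ∀ a b : G, IsLoxodromicElt S a → IsLoxodromicElt S b →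
      ElemSubset a ≠ ElemSubset b →
      ∀ n m : ℕ, C₀ ≤ n → C₀ ≤ m → IsLoxodromicElt S (a ^ n * b ^ m) := by
  have hD : FourPoint (2 * δ + 1) S := hhyp.2.fourPoint hhyp.1 (by linarith)
  have hS := hhyp.1.hasSegments
  have : IsIsometricSMul G S := ⟨hiso⟩
  obtain ⟨R, N, hR, hA⟩ := hacyl (450000 * (2 * δ + 1)) (by linarith)
  obtain ⟨C, hC⟩ := exists_nat_ge (4 * N + N * (4 * R + 40000 * (2 * δ + 1)) + 2)
  refine ⟨C, fun a b ha hb hab n m hn hm => ?_⟩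
  by_contra hlox
  have : Nonempty S := ⟨ha.choose⟩
  obtain ⟨y, hy⟩ := exists_dist_smul_le_of_not_isLoxodromicElt hD hS (by linarith) hlox
  have hy' : dist ((a⁻¹ ^ n) • y) ((b ^ m) • y) ≤ 4 * (2 * δ + 1) := by
    rwa [← dist_smul (a ^ n), smul_smul, smul_smul, inv_pow, mul_inv_cancel, one_smul]
  have h := elemSubset_eq_of_dist_pow_smul_le hD hS (by linarith) hacyl hR hA ha.inv hb
    (hC.trans (by exact_mod_cast hn)) (hC.trans (by exact_mod_cast hm)) hy'
  rw [elemSubset_inv] at h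
  exact hab h
end
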